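/- Let T be a locally satisfiable negative local theory and E an equivalence class of the compatibility relation on the class of local positively closed models of T. Then: (1) a member C of E is a retractor of T if and only if C is absolutely universal for E; (2) there is at most one retractor of T in E up to isomorphism; (3) there is a retractor of T in E if and only if E is bounded, i.e. there is a cardinal κ bounding the cardinalities of all members of E. -/

import Mathlib

noncomputable section

structure LocalLanguage : Type 1 where
  Sorts : Type
  Rel : (n : ℕ) → (Fin n → Sorts) → Type
  Const : Sorts → Type
  Loc : Sorts → Type
  locToRel : {s : Sorts} → Loc s → Rel 2 ![s, s]
  dd0 : (s : Sorts) → Loc s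
  locMul : {s : Sorts} → Loc s → Loc s → Loc s
  locLe : {s : Sorts} → Loc s → Loc s → Prop
  locMul_assoc : ∀ {s} (d₁ d₂ d₃ : Loc s), locMul (locMul d₁ d₂) d₃ = locMul d₁ (locMul d₂ d₃)
  dd0_locMul : ∀ {s} (d : Loc s), locMul (dd0 s) d = d
  locMul_dd0 : ∀ {s} (d : Loc s), locMul d (dd0 s) = d
  locLe_refl : ∀ {s} (d : Loc s), locLe d d
  locLe_trans : ∀ {s} (d₁ d₂ d₃ : Loc s), locLe d₁ d₂ → locLe d₂ d₃ → locLe d₁ d₃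
  locLe_antisymm : ∀ {s} (d₁ d₂ : Loc s), locLe d₁ d₂ → locLe d₂ d₁ → d₁ = d₂
  dd0_locLe : ∀ {s} (d : Loc s), locLe (dd0 s) d
  locMul_mono : ∀ {s} (d₁ d₂ e₁ e₂ : Loc s), locLe d₁ e₁ → locLe d₂ e₂ →
    locLe (locMul d₁ d₂) (locMul e₁ e₂)
  bound : {s : Sorts} → Const s → Const s → Loc s

structure LStructure (L : LocalLanguage) : Type 1 where
  Dom : L.Sorts → Type
  relMap : {n : ℕ} → {ρ : Fin n → L.Sorts} → L.Rel n ρ → ((i : Fin n) → Dom (ρ i)) → Prop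
  constMap : {s : L.Sorts} → L.Const s → Dom s

def dpair {C : Fin 2 → Sort*} (a : C 0) (b : C 1) : (i : Fin 2) → C i
  | ⟨0, _⟩ => a
  | ⟨1, _⟩ => b

def LStructure.locRel {L : LocalLanguage} (M : LStructure L) {s : L.Sorts}
    (d : L.Loc s) (a b : M.Dom s) : Prop :=
  M.relMap (L.locToRel d) (dpair a b)

structure IsLocal {L : LocalLanguage} (M : LStructure L) : Prop where
  symm : ∀ {s : L.Sorts} (d : L.Loc s) (a b : M.Dom s), M.locRel d a b → M.locRel d b a
  mono : ∀ {s : L.Sorts} (d₁ d₂ : L.Loc s), L.locLe d₁ d₂ →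
    ∀ (a b : M.Dom s), M.locRel d₁ a b → M.locRel d₂ a b
  comp : ∀ {s : L.Sorts} (d₁ d₂ : L.Loc s) (a b c : M.Dom s),
    M.locRel d₁ a b → M.locRel d₂ b c → M.locRel (L.locMul d₁ d₂) a c
  boundAx : ∀ {s : L.Sorts} (c₁ c₂ : L.Const s),
    M.locRel (L.bound c₁ c₂) (M.constMap c₁) (M.constMap c₂)
  total : ∀ {s : L.Sorts} (a b : M.Dom s), ∃ d : L.Loc s, M.locRel d a b
  dd0_eq : ∀ {s : L.Sorts} (a b : M.Dom s), M.locRel (L.dd0 s) a b ↔ a = b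

/-! ## Syntax -/

/-- Terms: variables or constants (the language is relational). -/
inductive LTerm (L : LocalLanguage) (α : Type) (σ : α → L.Sorts) : L.Sorts → Type
  | var (a : α) : LTerm L α σ (σ a)
  | const {s : L.Sorts} (c : L.Const s) : LTerm L α σ s

/-- Sort assignment for a context extended by one variable of sort `s`. -/
abbrev osort {L : LocalLanguage} {α : Type} (s : L.Sorts) (σ : α → L.Sorts) :
    Option α → L.Sorts :=
  fun o => Option.elim o s σ

/-- Positive formulas: atomic, conjunction, disjunction, existential quantification. -/
inductive PosForm (L : LocalLanguage) : (α : Type) → (α → L.Sorts) → Type 1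
  | rel {α : Type} {σ : α → L.Sorts} {n : ℕ} {ρ : Fin n → L.Sorts}
      (R : L.Rel n ρ) (ts : (i : Fin n) → LTerm L α σ (ρ i)) : PosForm L α σ
  | and {α : Type} {σ : α → L.Sorts} (φ ψ : PosForm L α σ) : PosForm L α σ
  | or {α : Type} {σ : α → L.Sorts} (φ ψ : PosForm L α σ) : PosForm L α σ
  | ex {α : Type} {σ : α → L.Sorts} (s : L.Sorts)
      (φ : PosForm L (Option α) (osort s σ)) : PosForm L α σ

/-- Local positive formulas: atomic, conjunction, disjunction, local existential
quantification `∃ x ∈ d(t) φ`. -/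
inductive LPosForm (L : LocalLanguage) : (α : Type) → (α → L.Sorts) → Type 1
  | rel {α : Type} {σ : α → L.Sorts} {n : ℕ} {ρ : Fin n → L.Sorts}
      (R : L.Rel n ρ) (ts : (i : Fin n) → LTerm L α σ (ρ i)) : LPosForm L α σ
  | and {α : Type} {σ : α → L.Sorts} (φ ψ : LPosForm L α σ) : LPosForm L α σ
  | or {α : Type} {σ : α → L.Sorts} (φ ψ : LPosForm L α σ) : LPosForm L α σ
  | lex {α : Type} {σ : α → L.Sorts} (s : L.Sorts) (d : L.Loc s) (t : LTerm L α σ s)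
      (φ : LPosForm L (Option α) (osort s σ)) : LPosForm L α σ

/-- Local formulas: atomic, negation, conjunction, local existential quantification. -/
inductive LForm (L : LocalLanguage) : (α : Type) → (α → L.Sorts) → Type 1
  | rel {α : Type} {σ : α → L.Sorts} {n : ℕ} {ρ : Fin n → L.Sorts}
      (R : L.Rel n ρ) (ts : (i : Fin n) → LTerm L α σ (ρ i)) : LForm L α σ
  | not {α : Type} {σ : α → L.Sorts} (φ : LForm L α σ) : LForm L α σ
  | and {α : Type} {σ : α → L.Sorts} (φ ψ : LForm L α σ) : LForm L α σ
  | lex {α : Type} {σ : α → L.Sorts} (s : L.Sorts) (d : L.Loc s) (t : LTerm L α σ s)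
      (φ : LForm L (Option α) (osort s σ)) : LForm L α σ

/-! ## Semantics -/

def LTerm.realize {L : LocalLanguage} (M : LStructure L) {α : Type} {σ : α → L.Sorts}
    (v : (a : α) → M.Dom (σ a)) : {s : L.Sorts} → LTerm L α σ s → M.Dom s
  | _, .var a => v a
  | _, .const c => M.constMap c

/-- Extension of a valuation by a value for the new variable. -/
def vcons {L : LocalLanguage} {M : LStructure L} {α : Type} {σ : α → L.Sorts} {s : L.Sorts}
    (x : M.Dom s) (v : (a : α) → M.Dom (σ a)) : (o : Option α) → M.Dom (osort s σ o)
  | none => x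
  | some a => v a

def PosForm.Realize {L : LocalLanguage} (M : LStructure L) :
    {α : Type} → {σ : α → L.Sorts} → PosForm L α σ → ((a : α) → M.Dom (σ a)) → Prop
  | _, _, .rel R ts, v => M.relMap R (fun i => (ts i).realize M v)
  | _, _, .and φ ψ, v => φ.Realize M v ∧ ψ.Realize M v
  | _, _, .or φ ψ, v => φ.Realize M v ∨ ψ.Realize M v
  | _, _, .ex s φ, v => ∃ x : M.Dom s, φ.Realize M (vcons x v)

def LPosForm.Realize {L : LocalLanguage} (M : LStructure L) :
    {α : Type} → {σ : α → L.Sorts} → LPosForm L α σ → ((a : α) → M.Dom (σ a)) → Prop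
  | _, _, .rel R ts, v => M.relMap R (fun i => (ts i).realize M v)
  | _, _, .and φ ψ, v => φ.Realize M v ∧ ψ.Realize M v
  | _, _, .or φ ψ, v => φ.Realize M v ∨ ψ.Realize M v
  | _, _, .lex s d t φ, v =>
      ∃ x : M.Dom s, M.locRel d x (t.realize M v) ∧ φ.Realize M (vcons x v)

def LForm.Realize {L : LocalLanguage} (M : LStructure L) :
    {α : Type} → {σ : α → L.Sorts} → LForm L α σ → ((a : α) → M.Dom (σ a)) → Prop
  | _, _, .rel R ts, v => M.relMap R (fun i => (ts i).realize M v)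
  | _, _, .not φ, v => ¬ φ.Realize M v
  | _, _, .and φ ψ, v => φ.Realize M v ∧ ψ.Realize M v
  | _, _, .lex s d t φ, v =>
      ∃ x : M.Dom s, M.locRel d x (t.realize M v) ∧ φ.Realize M (vcons x v)

/-- Quantifier-free positive formulas. -/
inductive PosForm.IsQF {L : LocalLanguage} : {α : Type} → {σ : α → L.Sorts} → PosForm L α σ → Prop
  | rel {α : Type} {σ : α → L.Sorts} {n : ℕ} {ρ : Fin n → L.Sorts}
      (R : L.Rel n ρ) (ts : (i : Fin n) → LTerm L α σ (ρ i)) : PosForm.IsQF (.rel R ts)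
  | and {α : Type} {σ : α → L.Sorts} {φ ψ : PosForm L α σ} :
      PosForm.IsQF φ → PosForm.IsQF ψ → PosForm.IsQF (.and φ ψ)
  | or {α : Type} {σ : α → L.Sorts} {φ ψ : PosForm L α σ} :
      PosForm.IsQF φ → PosForm.IsQF ψ → PosForm.IsQF (.or φ ψ)


/-! ## Sentences, theories, models -/

/-- Sort assignment for the empty context. -/
abbrev emptySorts (L : LocalLanguage) : Empty → L.Sorts := fun e => e.elim

/-- Positive sentences. -/
abbrev PosSentence (L : LocalLanguage) := PosForm L Empty (emptySorts L)

/-- A positive sentence holds in a structure. -/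
def PosSentence.RealizedIn {L : LocalLanguage} (φ : PosSentence L) (M : LStructure L) : Prop :=
  φ.Realize M (fun e => e.elim)

/-- We represent a negative theory by the set of positive sentences whose negations
belong to it.  `M` is a local model of `T` if `M` is local and satisfies the negation of
every positive sentence in `T`. -/
def LocalModel {L : LocalLanguage} (M : LStructure L) (T : Set (PosSentence L)) : Prop :=
  IsLocal M ∧ ∀ φ ∈ T, ¬ φ.RealizedIn M

/-- `T` (a set of positive sentences standing for the negative theory `{¬φ : φ ∈ T}`)
is a negative local theory if it is closed under local implication: any negative sentence
true in every local model of `T` is already in `T`. -/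
def IsNegLocalTheory {L : LocalLanguage} (T : Set (PosSentence L)) : Prop :=
  ∀ φ : PosSentence L, (∀ M : LStructure L, LocalModel M T → ¬ φ.RealizedIn M) → φ ∈ T

/-- `T` is locally satisfiable: it has a local model. -/
def LocSat {L : LocalLanguage} (T : Set (PosSentence L)) : Prop :=
  ∃ M : LStructure L, LocalModel M T

/-- The negative theory of a structure (as the set of positive sentences failing in it). -/
def ThNeg {L : LocalLanguage} (M : LStructure L) : Set (PosSentence L) :=
  {φ | ¬ φ.RealizedIn M}

/-! ## Homomorphisms -/

structure LHom {L : LocalLanguage} (M N : LStructure L) where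
  toFun : (s : L.Sorts) → M.Dom s → N.Dom s
  map_rel : ∀ {n : ℕ} {ρ : Fin n → L.Sorts} (R : L.Rel n ρ) (x : (i : Fin n) → M.Dom (ρ i)),
    M.relMap R x → N.relMap R (fun i => toFun (ρ i) (x i))
  map_const : ∀ {s : L.Sorts} (c : L.Const s), toFun s (M.constMap c) = N.constMap c

def LHom.comp {L : LocalLanguage} {M N P : LStructure L} (g : LHom N P) (f : LHom M N) :
    LHom M P where
  toFun s := g.toFun s ∘ f.toFun s
  map_rel R x h := g.map_rel R _ (f.map_rel R x h)
  map_const c := by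
    simp only [Function.comp_apply, f.map_const, g.map_const]

def LHom.id {L : LocalLanguage} (M : LStructure L) : LHom M M where
  toFun _ := fun x => x
  map_rel _ _ h := h
  map_const _ := rfl

/-- A homomorphism is a positive embedding if it reflects all positive formulas. -/
def LHom.IsPosEmbedding {L : LocalLanguage} {M N : LStructure L} (h : LHom M N) : Prop :=
  ∀ (α : Type) (σ : α → L.Sorts) (φ : PosForm L α σ) (v : (a : α) → M.Dom (σ a)),
    φ.Realize N (fun a => h.toFun (σ a) (v a)) → φ.Realize M v

/-- A local positively closed model of `T`. -/
def IsPC {L : LocalLanguage} (M : LStructure L) (T : Set (PosSentence L)) : Prop :=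
  LocalModel M T ∧
    ∀ (N : LStructure L) (h : LHom M N), LocalModel N T → h.IsPosEmbedding

/-- An endomorphism is an automorphism if it has a two-sided inverse homomorphism. -/
def LHom.IsAuto {L : LocalLanguage} {M : LStructure L} (f : LHom M M) : Prop :=
  ∃ g : LHom M M, g.comp f = LHom.id M ∧ f.comp g = LHom.id M

/-- Isomorphism of structures. -/
def Isomorphic {L : LocalLanguage} (M N : LStructure L) : Prop :=
  ∃ (f : LHom M N) (g : LHom N M), g.comp f = LHom.id M ∧ f.comp g = LHom.id N

/-! ## Types -/

/-- The local positive type of a tuple. -/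
def ltp {L : LocalLanguage} (M : LStructure L) {α : Type} {σ : α → L.Sorts}
    (v : (a : α) → M.Dom (σ a)) : Set (LPosForm L α σ) :=
  {φ | φ.Realize M v}

/-- The positive type of a tuple. -/
def ptp {L : LocalLanguage} (M : LStructure L) {α : Type} {σ : α → L.Sorts}
    (v : (a : α) → M.Dom (σ a)) : Set (PosForm L α σ) :=
  {φ | φ.Realize M v}

/-- A partial local positive type of `T` on `(α, σ)`: a set of local positive formulas
realized by some tuple in some local model of `T`. -/
def IsPartialLType {L : LocalLanguage} (T : Set (PosSentence L)) {α : Type}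
    {σ : α → L.Sorts} (Γ : Set (LPosForm L α σ)) : Prop :=
  ∃ (M : LStructure L) (v : (a : α) → M.Dom (σ a)),
    LocalModel M T ∧ ∀ φ ∈ Γ, LPosForm.Realize M φ v

/-- A local positive type: a maximal partial local positive type. -/
def IsLType {L : LocalLanguage} (T : Set (PosSentence L)) {α : Type}
    {σ : α → L.Sorts} (Γ : Set (LPosForm L α σ)) : Prop :=
  IsPartialLType T Γ ∧ ∀ Γ' : Set (LPosForm L α σ), IsPartialLType T Γ' → Γ ⊆ Γ' → Γ' = Γ

/-- A variable `(α, σ)` is pointed if every sort not occurring among its sorts carries a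
constant symbol. -/
def VPointed {L : LocalLanguage} {α : Type} (σ : α → L.Sorts) : Prop :=
  ∀ s : L.Sorts, s ∉ Set.range σ → Nonempty (L.Const s)


/-! ## Bounds and bounded satisfiability -/

/-- Pair of terms as arguments for a binary relation symbol. -/
def tpair {L : LocalLanguage} {α : Type} {σ : α → L.Sorts} {s t : L.Sorts}
    (t₁ : LTerm L α σ s) (t₂ : LTerm L α σ t) : (i : Fin 2) → LTerm L α σ (![s, t] i) :=
  dpair t₁ t₂

/-- A bound of the variable `(α, σ)`: a choice, for every single variable whose sort
carries a constant symbol, of a locality relation and a constant, and for every pair of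
single variables of the same sort, of a locality relation. -/
structure VBound (L : LocalLanguage) (α : Type) (σ : α → L.Sorts) where
  dConst : (a : α) → Nonempty (L.Const (σ a)) → L.Loc (σ a)
  cConst : (a : α) → Nonempty (L.Const (σ a)) → L.Const (σ a)
  dPair : (a b : α) → σ a = σ b → L.Loc (σ a)

/-- The set of (atomic, quantifier-free) local positive formulas making up a bound:
`d_a(x_a, c_a)` and `d_{a,b}(x_a, x_b)`. -/
def VBound.toSet {L : LocalLanguage} {α : Type} {σ : α → L.Sorts} (B : VBound L α σ) :
    Set (LPosForm L α σ) :=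
  {φ | (∃ (a : α) (h : Nonempty (L.Const (σ a))),
          φ = LPosForm.rel (L.locToRel (B.dConst a h))
                (tpair (LTerm.var a) (LTerm.const (B.cConst a h)))) ∨
       (∃ (a b : α) (e : σ a = σ b),
          φ = LPosForm.rel (L.locToRel (B.dPair a b e))
                (tpair (LTerm.var a) (e.symm ▸ LTerm.var b)))}

/-- A bound holds of a tuple if all its formulas do. -/
def VBound.Holds {L : LocalLanguage} {α : Type} {σ : α → L.Sorts} (B : VBound L α σ)
    (M : LStructure L) (v : (a : α) → M.Dom (σ a)) : Prop :=
  ∀ ψ ∈ B.toSet, LPosForm.Realize M ψ v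

/-- Finite local satisfiability of a set of local positive formulas in `T`. -/
def FinLocSat {L : LocalLanguage} (T : Set (PosSentence L)) {α : Type} {σ : α → L.Sorts}
    (Δ : Set (LPosForm L α σ)) : Prop :=
  ∀ Δ₀ ⊆ Δ, Δ₀.Finite →
    ∃ (M : LStructure L) (v : (a : α) → M.Dom (σ a)),
      LocalModel M T ∧ ∀ φ ∈ Δ₀, LPosForm.Realize M φ v

/-- Bounded satisfiability: for some bound `B`, `Γ ∪ B` is finitely locally satisfiable. -/
def BoundedlySat {L : LocalLanguage} (T : Set (PosSentence L)) {α : Type}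
    {σ : α → L.Sorts} (Γ : Set (LPosForm L α σ)) : Prop :=
  ∃ B : VBound L α σ, FinLocSat T (Γ ∪ B.toSet)

/-! ## Π₁-local formulas -/

/-- Dependent `Sum.elim` of valuations. -/
def sval {L : LocalLanguage} {M : LStructure L} {α β : Type} {σ : α → L.Sorts}
    {τ : β → L.Sorts} (v : (a : α) → M.Dom (σ a)) (w : (b : β) → M.Dom (τ b)) :
    (x : α ⊕ β) → M.Dom (Sum.elim σ τ x)
  | .inl a => v a
  | .inr b => w b

/-- A Π₁-local formula: a universally quantified local formula. -/
structure Pi1LForm (L : LocalLanguage) (α : Type) (σ : α → L.Sorts) : Type 1 where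
  n : ℕ
  τ : Fin n → L.Sorts
  matrix : LForm L (α ⊕ Fin n) (Sum.elim σ τ)

def Pi1LForm.Realize {L : LocalLanguage} {α : Type} {σ : α → L.Sorts}
    (φ : Pi1LForm L α σ) (M : LStructure L) (v : (a : α) → M.Dom (σ a)) : Prop :=
  ∀ w : (i : Fin φ.n) → M.Dom (φ.τ i), φ.matrix.Realize M (sval v w)

/-- Bounded satisfiability of a set of Π₁-local formulas: for some bound `B`, every
finite subset of `Γ` together with every finite part of `B` is realized in a local
model of `T`. -/
def Pi1BoundedlySat {L : LocalLanguage} (T : Set (PosSentence L)) {α : Type}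
    {σ : α → L.Sorts} (Γ : Set (Pi1LForm L α σ)) : Prop :=
  ∃ B : VBound L α σ,
    ∀ Γ₀ ⊆ Γ, Γ₀.Finite → ∀ F ⊆ B.toSet, F.Finite →
      ∃ (M : LStructure L) (v : (a : α) → M.Dom (σ a)),
        LocalModel M T ∧ (∀ φ ∈ Γ₀, Pi1LForm.Realize φ M v) ∧
          (∀ ψ ∈ F, LPosForm.Realize M ψ v)

/-! ## Cardinality, homogeneity, retractors -/

/-- The cardinality of a structure: that of the disjoint union of its sorts. -/
def LStructure.card {L : LocalLanguage} (M : LStructure L) : Cardinal :=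
  Cardinal.mk (Σ s : L.Sorts, M.Dom s)

/-- The cardinality of a local language. -/
def LocalLanguage.card (L : LocalLanguage) : Cardinal :=
  max Cardinal.aleph0
    (Cardinal.mk (L.Sorts ⊕ (Σ s : L.Sorts, L.Const s) ⊕ (Σ s : L.Sorts, L.Loc s) ⊕
      (Σ (n : ℕ) (ρ : Fin n → L.Sorts), L.Rel n ρ)))

/-- `M` is a (local positively) κ-ultrahomogeneous model of `T`. -/
def IsUltrahomogeneous {L : LocalLanguage} (T : Set (PosSentence L)) (M : LStructure L)
    (κ : Cardinal) : Prop :=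
  ∀ A B : LStructure L, LocalModel A T → LocalModel B T → A.card < κ → B.card < κ →
    ∀ f : LHom A M, f.IsPosEmbedding → ∀ g : LHom A B, ∃ h : LHom B M, h.comp g = f

/-- A retractor of `T`: a local model of `T` such that every homomorphism into a local
model of `T` has a retraction. -/
def IsRetractor {L : LocalLanguage} (T : Set (PosSentence L)) (C : LStructure L) : Prop :=
  LocalModel C T ∧
    ∀ N : LStructure L, LocalModel N T →
      ∀ f : LHom C N, ∃ g : LHom N C, g.comp f = LHom.id C

/-- `M` is κ-universal for a class `K` of structures. -/
def IsUniversal {L : LocalLanguage} (M : LStructure L) (K : LStructure L → Prop)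
    (κ : Cardinal) : Prop :=
  ∀ N : LStructure L, K N → N.card < κ → Nonempty (LHom N M)

/-- `M` is absolutely universal for a class `K` of structures. -/
def IsAbsUniversal {L : LocalLanguage} (M : LStructure L) (K : LStructure L → Prop) : Prop :=
  ∀ N : LStructure L, K N → Nonempty (LHom N M)

/-- Compatibility of two local models of `T`. -/
def Compat {L : LocalLanguage} (T : Set (PosSentence L)) (A B : LStructure L) : Prop :=
  ∃ M : LStructure L, LocalModel M T ∧ Nonempty (LHom A M) ∧ Nonempty (LHom B M)

/-- The local joint (homomorphism) property. -/
def HasLJP {L : LocalLanguage} (T : Set (PosSentence L)) : Prop :=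
  ∀ A B : LStructure L, LocalModel A T → LocalModel B T →
    ∃ M : LStructure L, LocalModel M T ∧ Nonempty (LHom A M) ∧ Nonempty (LHom B M)


/-! ## Parameters -/

/-- A set of parameters in a structure. -/
def ParamSet {L : LocalLanguage} (M : LStructure L) := (s : L.Sorts) → Set (M.Dom s)

/-- Interpretation in `M` of old and new constants of the expanded language. -/
def paramInterp {L : LocalLanguage} (M : LStructure L) (A : ParamSet M) {s : L.Sorts} :
    L.Const s ⊕ (A s) → M.Dom s
  | .inl c => M.constMap c
  | .inr a => a.1

/-- The expansion `L(A)` of `L` by new constants for the parameters `A` of a local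
structure `M`; bounds for pairs involving the new constants are chosen (by locality
axiom (A5)) so that they hold in `M`. -/
noncomputable def LocalLanguage.withParams (L : LocalLanguage) (M : LStructure L)
    (hM : IsLocal M) (A : ParamSet M) : LocalLanguage where
  Sorts := L.Sorts
  Rel := L.Rel
  Const s := L.Const s ⊕ (A s)
  Loc := L.Loc
  locToRel := L.locToRel
  dd0 := L.dd0
  locMul := L.locMul
  locLe := L.locLe
  locMul_assoc := L.locMul_assoc
  dd0_locMul := L.dd0_locMul
  locMul_dd0 := L.locMul_dd0
  locLe_refl := L.locLe_refl
  locLe_trans := L.locLe_trans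
  locLe_antisymm := L.locLe_antisymm
  dd0_locLe := L.dd0_locLe
  locMul_mono := L.locMul_mono
  bound := fun {_s} c₁ c₂ =>
    match c₁, c₂ with
    | .inl c₁, .inl c₂ => L.bound c₁ c₂
    | c₁, c₂ => Classical.choose (hM.total (paramInterp M A c₁) (paramInterp M A c₂))

/-- The natural expansion `M_A` of `M` to an `L(A)`-structure. -/
noncomputable def LStructure.withParams {L : LocalLanguage} (M : LStructure L)
    (hM : IsLocal M) (A : ParamSet M) : LStructure (L.withParams M hM A) where
  Dom := M.Dom
  relMap := M.relMap
  constMap := paramInterp M A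

/-- `M` has the local joint property over `A`: any two local models of `Th₋(M/A)` map
into a common local model of `Th₋(M/A)`. -/
def HasLJPOver {L : LocalLanguage} (M : LStructure L) (hM : IsLocal M) (A : ParamSet M) :
    Prop :=
  HasLJP (ThNeg (M.withParams hM A))

/-- `M` is (local positively) κ-saturated: it realizes every local positive type of
`Th₋(M/A)` on `x` whenever `|x| < κ`, `|A| < κ` and `M` has the local joint property
over `A`. -/
def IsSaturatedAt {L : LocalLanguage} (M : LStructure L) (hM : IsLocal M)
    (κ : Cardinal) : Prop :=
  ∀ A : ParamSet M, Cardinal.mk (Σ s : L.Sorts, A s) < κ → HasLJPOver M hM A →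
    ∀ (α : Type) (σ : α → L.Sorts), Cardinal.mk α < κ →
      ∀ Γ : Set (LPosForm (L.withParams M hM A) α σ),
        IsLType (ThNeg (M.withParams hM A)) Γ →
          ∃ v : (a : α) → M.Dom (σ a), ∀ φ ∈ Γ, LPosForm.Realize (M.withParams hM A) φ v

/-- The local positive type of a tuple over a set of parameters `A`, rendered as the set
of local positive formulas with extra free variables for the parameters of `A` that are
satisfied when those variables are evaluated at the parameters themselves. -/
def ltpOver {L : LocalLanguage} (M : LStructure L) (A : ParamSet M) {α : Type}
    {σ : α → L.Sorts} (v : (a : α) → M.Dom (σ a)) :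
    Set (LPosForm L (α ⊕ Σ s : L.Sorts, A s) (Sum.elim σ (fun p => p.1))) :=
  {φ | φ.Realize M (sval v (fun p => p.2.1))}

/-! ## Substructures -/

/-- A substructure of `M`: a family of subsets closed under the constants (the language
is relational). -/
structure Substruct {L : LocalLanguage} (M : LStructure L) where
  carrier : (s : L.Sorts) → Set (M.Dom s)
  const_mem : ∀ {s : L.Sorts} (c : L.Const s), M.constMap c ∈ carrier s

/-- The induced structure on a substructure. -/
def Substruct.toStruct {L : LocalLanguage} {M : LStructure L} (A : Substruct M) :
    LStructure L where
  Dom s := A.carrier s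
  relMap R x := M.relMap R (fun i => (x i).1)
  constMap c := ⟨M.constMap c, A.const_mem c⟩


/-! ## Topologies -/

/-- The `d`-ball at `a`. -/
def LStructure.ball {L : LocalLanguage} (M : LStructure L) {s : L.Sorts} (d : L.Loc s)
    (a : M.Dom s) : Set (M.Dom s) :=
  {b | M.locRel d a b}

/-- The local positive logic topology on a single sort of `M`: closed sets are the
subsets defined by sets of local positive formulas with parameters in `M` (parameters
being rendered as extra free variables evaluated at themselves). -/
def lpTopologyS {L : LocalLanguage} (M : LStructure L) (s : L.Sorts) :
    TopologicalSpace (M.Dom s) :=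
  TopologicalSpace.generateFrom
    {U | ∃ φ : LPosForm L (Unit ⊕ Σ s' : L.Sorts, M.Dom s')
            (Sum.elim (fun _ => s) (fun p => p.1)),
      U = {x | ¬ LPosForm.Realize M φ (sval (fun _ => x) (fun p => p.2))}}

/-- The space of local positive types of `T` on the variable `(α, σ)`. -/
def LTypeSpace (L : LocalLanguage) (T : Set (PosSentence L)) (α : Type)
    (σ : α → L.Sorts) :=
  {Γ : Set (LPosForm L α σ) // IsLType T Γ}

/-- The local positive logic topology on the space of local positive types: generated by
declaring `⟨φ⟩ = {p : φ ∈ p}` closed for every local positive formula `φ`; its closed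
sets are then exactly the sets `⟨Γ⟩` together with `∅`. -/
instance {L : LocalLanguage} (T : Set (PosSentence L)) (α : Type) (σ : α → L.Sorts) :
    TopologicalSpace (LTypeSpace L T α σ) :=
  TopologicalSpace.generateFrom
    {U | ∃ φ : LPosForm L α σ, U = {p : LTypeSpace L T α σ | φ ∉ p.1}}

/-! ## Completeness and compactness -/

/-- `T` is complete: `T = Th₋(M)` for every local positively closed model `M` of `T`. -/
def IsCompleteTheory {L : LocalLanguage} (T : Set (PosSentence L)) : Prop :=
  ∀ M : LStructure L, IsPC M T → ThNeg M = T

/-- `T` is local positively compact. -/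
def IsLocPosCompact {L : LocalLanguage} (T : Set (PosSentence L)) : Prop :=
  ∀ (s : L.Sorts) (γ : Type), Finite γ →
    ∀ (τ : γ → L.Sorts) (φ : LPosForm L (Fin 2 ⊕ γ) (Sum.elim (fun _ => s) τ)),
      (∀ M : LStructure L, LocalModel M T →
        ∀ (a : M.Dom s) (w : (j : γ) → M.Dom (τ j)),
          ¬ LPosForm.Realize M φ (sval ![a, a] w)) →
      ∀ (B : VBound L (Unit ⊕ γ) (Sum.elim (fun _ => s) τ)) (d : L.Loc s),
        ∃ k : ℕ, 0 < k ∧ ∀ M : LStructure L, LocalModel M T →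
          ¬ ∃ (a : Fin k → M.Dom s) (w : (j : γ) → M.Dom (τ j)),
            ∀ i j : Fin k, i ≠ j →
              B.Holds M (sval (fun _ => a i) w) ∧ M.locRel d (a i) (a j) ∧
                LPosForm.Realize M φ (sval ![a i, a j] w)

/-! ## Homomorphisms and positive formulas -/

section Homomorphisms

variable {L : LocalLanguage}

theorem LHom.ext {M N : LStructure L} {f g : LHom M N}
    (h : ∀ s x, f.toFun s x = g.toFun s x) : f = g := by
  cases f
  cases g
  congr
  funext s x
  exact h s x

theorem LHom.congr_apply {M N : LStructure L} {f g : LHom M N} (h : f = g) (s : L.Sorts)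
    (x : M.Dom s) : f.toFun s x = g.toFun s x := by
  rw [h]

theorem map_dpair {X Y : L.Sorts → Type} (g : ∀ s, X s → Y s) {s : L.Sorts} (a b : X s) :
    (fun i => g (![s, s] i) ((dpair a b : (i : Fin 2) → X (![s, s] i)) i)) =
      (dpair (g s a) (g s b) : (i : Fin 2) → Y (![s, s] i)) := by
  funext i
  match i with
  | ⟨0, _⟩ => rfl
  | ⟨1, _⟩ => rfl

theorem LHom.map_locRel {M N : LStructure L} (f : LHom M N) {s : L.Sorts} (d : L.Loc s)
    {a b : M.Dom s} (h : M.locRel d a b) : N.locRel d (f.toFun s a) (f.toFun s b) := by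
  have h' := f.map_rel _ _ h
  rwa [map_dpair f.toFun a b] at h'

theorem LHom.locRel_of_reflects {M N : LStructure L} (f : LHom M N)
    (hf : ∀ {n : ℕ} {ρ : Fin n → L.Sorts} (R : L.Rel n ρ) (x : (i : Fin n) → M.Dom (ρ i)),
      N.relMap R (fun i => f.toFun _ (x i)) → M.relMap R x)
    {s : L.Sorts} (d : L.Loc s) {a b : M.Dom s}
    (h : N.locRel d (f.toFun s a) (f.toFun s b)) : M.locRel d a b := by
  refine hf _ _ ?_
  rw [map_dpair f.toFun a b]
  exact h

theorem map_vcons {M N : LStructure L} (g : ∀ s, M.Dom s → N.Dom s) {α : Type}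
    {σ : α → L.Sorts} {s : L.Sorts} (x : M.Dom s) (v : (a : α) → M.Dom (σ a)) :
    (fun o => g (osort s σ o) (vcons x v o)) = vcons (g s x) (fun a => g (σ a) (v a)) := by
  funext o
  cases o <;> rfl

theorem LHom.realize_term {M N : LStructure L} (f : LHom M N) {α : Type} {σ : α → L.Sorts}
    (v : (a : α) → M.Dom (σ a)) {s : L.Sorts} (t : LTerm L α σ s) :
    t.realize N (fun a => f.toFun _ (v a)) = f.toFun _ (t.realize M v) := by
  cases t with
  | var a => rfl
  | const c => exact (f.map_const c).symm

theorem LHom.realize {M N : LStructure L} (f : LHom M N) {α : Type} {σ : α → L.Sorts}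
    (φ : PosForm L α σ) (v : (a : α) → M.Dom (σ a)) (h : φ.Realize M v) :
    φ.Realize N (fun a => f.toFun _ (v a)) := by
  induction φ with
  | rel R ts =>
    simp only [PosForm.Realize, f.realize_term] at h ⊢
    exact f.map_rel _ _ h
  | and φ ψ ihφ ihψ => exact ⟨ihφ v h.1, ihψ v h.2⟩
  | or φ ψ ihφ ihψ => exact h.imp (ihφ v) (ihψ v)
  | ex s φ ih =>
    obtain ⟨x, hx⟩ := h
    refine ⟨f.toFun s x, ?_⟩
    rw [← map_vcons]
    exact ih _ hx

theorem PosSentence.realizedIn_of_realize {M : LStructure L} (φ : PosSentence L)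
    (v : (a : Empty) → M.Dom (emptySorts L a)) (h : φ.Realize M v) : φ.RealizedIn M := by
  have e : v = fun a => a.elim := funext fun a => a.elim
  rwa [e] at h

theorem LHom.realizedIn {M N : LStructure L} (f : LHom M N) (φ : PosSentence L)
    (h : φ.RealizedIn M) : φ.RealizedIn N :=
  PosSentence.realizedIn_of_realize φ _ (f.realize φ _ h)

theorem LHom.IsPosEmbedding.reflects {M N : LStructure L} {f : LHom M N}
    (hf : f.IsPosEmbedding) {n : ℕ} {ρ : Fin n → L.Sorts} (R : L.Rel n ρ)
    (x : (i : Fin n) → M.Dom (ρ i)) (h : N.relMap R (fun i => f.toFun _ (x i))) :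
    M.relMap R x :=
  hf (Fin n) ρ (.rel R fun i => .var i) x h

theorem LHom.IsPosEmbedding.injective {M N : LStructure L} {f : LHom M N}
    (hf : f.IsPosEmbedding) (hM : IsLocal M) (hN : IsLocal N) (s : L.Sorts) :
    Function.Injective (f.toFun s) := by
  intro a b hab
  refine (hM.dd0_eq a b).1 (f.locRel_of_reflects hf.reflects _ ?_)
  exact (hN.dd0_eq _ _).2 hab

theorem LHom.IsPosEmbedding.nonempty {M N : LStructure L} {f : LHom M N}
    (hf : f.IsPosEmbedding) (hN : IsLocal N) {s : L.Sorts} (x : N.Dom s) :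
    Nonempty (M.Dom s) := by
  have h : (PosForm.ex (α := Empty) (σ := emptySorts L) s
      (.rel (L.locToRel (L.dd0 s)) (tpair (.var none) (.var none)))).Realize N
        (fun a => f.toFun _ (a.elim)) := by
    refine ⟨x, ?_⟩
    have e : ∀ v : (o : Option Empty) → N.Dom (osort s (emptySorts L) o),
        (fun i => (tpair (L := L) (LTerm.var (σ := osort s (emptySorts L)) none)
          (LTerm.var (σ := osort s (emptySorts L)) none) i).realize N v) =
        (dpair (v none) (v none) : (i : Fin 2) → N.Dom (![s, s] i)) := by
      intro v
      funext i
      match i with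
      | ⟨0, _⟩ => rfl
      | ⟨1, _⟩ => rfl
    simp only [PosForm.Realize]
    have h' := (hN.dd0_eq x x).2 rfl
    exact (e _).symm ▸ h'
  obtain ⟨y, -⟩ := hf Empty (emptySorts L) _ (fun a => a.elim) h
  exact ⟨y⟩

end Homomorphisms

/-! ## Finite sets of atomic facts -/

section Facts

variable {L : LocalLanguage}

/-- An atomic fact about points of a sorted family. -/
structure AtomFact (L : LocalLanguage) (X : L.Sorts → Type) where
  n : ℕ
  ρ : Fin n → L.Sorts
  R : L.Rel n ρ
  x : (i : Fin n) → X (ρ i)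

/-- The image of the fact `f` under `g` holds in `P`. -/
def AtomFact.HoldsAt {X : L.Sorts → Type} (f : AtomFact L X) (P : LStructure L)
    (g : ∀ s, X s → P.Dom s) : Prop :=
  P.relMap f.R (fun i => g _ (f.x i))

/-- A fact about the points of a structure is true. -/
def AtomFact.Holds {M : LStructure L} (f : AtomFact L M.Dom) : Prop :=
  M.relMap f.R f.x

theorem LTerm.exists_support {N : LStructure L} {α : Type} {σ : α → L.Sorts} {s : L.Sorts}
    (t : LTerm L α σ s) (u : (a : α) → N.Dom (σ a)) :
    ∃ (A : Set α) (K : Set (Σ s, L.Const s)), A.Finite ∧ K.Finite ∧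
      ∀ (P : LStructure L) (v : (a : α) → P.Dom (σ a)) (g : ∀ s, N.Dom s → P.Dom s),
        (∀ a ∈ A, g _ (u a) = v a) → (∀ c ∈ K, g c.1 (N.constMap c.2) = P.constMap c.2) →
        g s (t.realize N u) = t.realize P v := by
  cases t with
  | var a =>
    exact ⟨{a}, ∅, Set.finite_singleton _, Set.finite_empty, fun P v g hA _ => hA a rfl⟩
  | const c =>
    exact ⟨∅, {⟨s, c⟩}, Set.finite_empty, Set.finite_singleton _, fun P v g _ hK => hK ⟨s, c⟩ rfl⟩

/-- Truth of a positive formula is witnessed by finitely many facts. -/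
theorem PosForm.exists_facts {N : LStructure L} {α : Type} {σ : α → L.Sorts}
    (φ : PosForm L α σ) (u : (a : α) → N.Dom (σ a)) (h : φ.Realize N u) :
    ∃ (Φ : Set (AtomFact L N.Dom)) (A : Set α) (K : Set (Σ s, L.Const s)),
      Φ.Finite ∧ A.Finite ∧ K.Finite ∧ (∀ f ∈ Φ, f.Holds) ∧
      ∀ (P : LStructure L) (v : (a : α) → P.Dom (σ a)) (g : ∀ s, N.Dom s → P.Dom s),
        (∀ f ∈ Φ, f.HoldsAt P g) → (∀ a ∈ A, g _ (u a) = v a) →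
        (∀ c ∈ K, g c.1 (N.constMap c.2) = P.constMap c.2) → φ.Realize P v := by
  induction φ with
  | @rel α σ n ρ R ts =>
    choose A K hA hK hts using fun i => (ts i).exists_support u
    refine ⟨{⟨n, ρ, R, fun i => (ts i).realize N u⟩}, ⋃ i, A i, ⋃ i, K i,
      Set.finite_singleton _, Set.finite_iUnion hA, Set.finite_iUnion hK, ?_, ?_⟩
    · rintro f rfl
      exact h
    · intro P v g hΦ hA' hK'
      have h' : P.relMap R (fun i => g _ ((ts i).realize N u)) := hΦ _ rfl
      have e : (fun i => g _ ((ts i).realize N u)) = fun i => (ts i).realize P v := by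
        funext i
        exact hts i P v g (fun a ha => hA' a (Set.mem_iUnion_of_mem i ha))
          (fun c hc => hK' c (Set.mem_iUnion_of_mem i hc))
      rwa [e] at h'
  | and φ ψ ihφ ihψ =>
    obtain ⟨Φ, A, K, hΦ, hA, hK, hT, H⟩ := ihφ u h.1
    obtain ⟨Φ', A', K', hΦ', hA', hK', hT', H'⟩ := ihψ u h.2
    refine ⟨Φ ∪ Φ', A ∪ A', K ∪ K', hΦ.union hΦ', hA.union hA', hK.union hK', ?_, ?_⟩
    · rintro f (hf | hf)
      exacts [hT f hf, hT' f hf]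
    · intro P v g h₁ h₂ h₃
      exact ⟨H P v g (fun f hf => h₁ f (.inl hf)) (fun f hf => h₂ f (.inl hf))
          (fun f hf => h₃ f (.inl hf)),
        H' P v g (fun f hf => h₁ f (.inr hf)) (fun f hf => h₂ f (.inr hf))
          (fun f hf => h₃ f (.inr hf))⟩
  | or φ ψ ihφ ihψ =>
    rcases h with h | h
    · obtain ⟨Φ, A, K, hΦ, hA, hK, hT, H⟩ := ihφ u h
      exact ⟨Φ, A, K, hΦ, hA, hK, hT, fun P v g h₁ h₂ h₃ => .inl (H P v g h₁ h₂ h₃)⟩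
    · obtain ⟨Φ, A, K, hΦ, hA, hK, hT, H⟩ := ihψ u h
      exact ⟨Φ, A, K, hΦ, hA, hK, hT, fun P v g h₁ h₂ h₃ => .inr (H P v g h₁ h₂ h₃)⟩
  | ex s φ ih =>
    obtain ⟨x, hx⟩ := h
    obtain ⟨Φ, A, K, hΦ, hA, hK, hT, H⟩ := ih _ hx
    refine ⟨Φ, some ⁻¹' A, K, hΦ, hA.preimage (Option.some_injective _).injOn, hK, hT, ?_⟩
    intro P v g h₁ h₂ h₃
    refine ⟨g s x, H P _ g h₁ ?_ h₃⟩
    rintro (_ | a) ha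
    · rfl
    · exact h₂ a ha

/-- Every finite part of `N` can be mapped back to `M`, fixing a given finite part of `M`. -/
def LHom.HasFinRetractions {M N : LStructure L} (f : LHom M N) : Prop :=
  ∀ (Φ : Set (AtomFact L N.Dom)) (A : Set (Σ s, M.Dom s)), Φ.Finite → A.Finite →
    (∀ φ ∈ Φ, φ.Holds) → ∃ g : ∀ s, N.Dom s → M.Dom s,
      (∀ φ ∈ Φ, φ.HoldsAt M g) ∧ ∀ a ∈ A, g a.1 (f.toFun a.1 a.2) = a.2

theorem LHom.HasFinRetractions.isPosEmbedding {M N : LStructure L} {f : LHom M N}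
    (hf : f.HasFinRetractions) : f.IsPosEmbedding := by
  intro α σ φ v h
  obtain ⟨Φ, A, K, hΦ, hA, hK, hT, H⟩ := φ.exists_facts _ h
  obtain ⟨g, hg, hgA⟩ := hf Φ
    ((fun a => ⟨σ a, v a⟩) '' A ∪ (fun c : Σ s, L.Const s => ⟨c.1, M.constMap c.2⟩) '' K) hΦ
    ((hA.image _).union (hK.image _)) hT
  refine H M v g hg (fun a ha => hgA _ (.inl ⟨a, ha, rfl⟩)) (fun c hc => ?_)
  rw [← f.map_const]
  exact hgA _ (.inr ⟨c, hc, rfl⟩)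

theorem exists_term {M : LStructure L} {α : Type} {σ : α → L.Sorts}
    (u : (a : α) → M.Dom (σ a)) (p : Σ s, M.Dom s)
    (hp : p ∈ Set.range fun a => (⟨σ a, u a⟩ : Σ s, M.Dom s)) :
    ∃ t : LTerm L α σ p.1, ∀ (P : LStructure L) (g : (p : Σ s, M.Dom s) → P.Dom p.1),
      t.realize P (fun a => g ⟨σ a, u a⟩) = g p := by
  obtain ⟨a, rfl⟩ := hp
  exact ⟨.var a, fun P g => rfl⟩

theorem exists_posForm_of_fact {M : LStructure L} {α : Type} {σ : α → L.Sorts}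
    (u : (a : α) → M.Dom (σ a)) (f : AtomFact L M.Dom)
    (hc : ∀ i, (⟨_, f.x i⟩ : Σ s, M.Dom s) ∈ Set.range fun a => (⟨σ a, u a⟩ : Σ s, M.Dom s)) :
    ∃ ψ : PosForm L α σ, ∀ (P : LStructure L) (g : (p : Σ s, M.Dom s) → P.Dom p.1),
      ψ.Realize P (fun a => g ⟨σ a, u a⟩) ↔ f.HoldsAt P (fun s x => g ⟨s, x⟩) := by
  choose t ht using fun i => exists_term u _ (hc i)
  refine ⟨.rel f.R t, fun P g => ?_⟩
  simp only [PosForm.Realize, ht]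
  rfl

theorem exists_posForm_of_facts_of_range {M : LStructure L} {α : Type} {σ : α → L.Sorts}
    (u : (a : α) → M.Dom (σ a)) (Φ : List (AtomFact L M.Dom)) (hne : Φ ≠ [])
    (hc : ∀ f ∈ Φ, ∀ i, (⟨_, f.x i⟩ : Σ s, M.Dom s) ∈
      Set.range fun a => (⟨σ a, u a⟩ : Σ s, M.Dom s)) :
    ∃ ψ : PosForm L α σ, ∀ (P : LStructure L) (g : (p : Σ s, M.Dom s) → P.Dom p.1),
      ψ.Realize P (fun a => g ⟨σ a, u a⟩) ↔ ∀ f ∈ Φ, f.HoldsAt P (fun s x => g ⟨s, x⟩) := by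
  induction Φ with
  | nil => exact absurd rfl hne
  | cons f Φ ih =>
    obtain ⟨ψ, hψ⟩ := exists_posForm_of_fact u f (hc f (by simp))
    by_cases hΦ : Φ = []
    · subst hΦ
      exact ⟨ψ, fun P g => by simp [hψ]⟩
    · obtain ⟨ψ', hψ'⟩ := ih hΦ (fun f' hf' => hc f' (by simp [hf']))
      refine ⟨.and ψ ψ', fun P g => ?_⟩
      simp only [PosForm.Realize, hψ, hψ', List.forall_mem_cons]

/-- Finitely many facts about a tuple and finitely many further points are expressed by a
positive formula about the tuple. -/
theorem exists_posForm_of_facts {M : LStructure L} (Φ : List (AtomFact L M.Dom)) (hne : Φ ≠ [])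
    (hT : ∀ f ∈ Φ, f.Holds) (l : List (Σ s, M.Dom s)) :
    ∀ {α : Type} {σ : α → L.Sorts} (u : (a : α) → M.Dom (σ a)),
      (∀ f ∈ Φ, ∀ i, (⟨_, f.x i⟩ : Σ s, M.Dom s) ∈
        (Set.range fun a => (⟨σ a, u a⟩ : Σ s, M.Dom s)) ∪ {p | p ∈ l}) →
      ∃ ψ : PosForm L α σ, ψ.Realize M u ∧
        ∀ (P : LStructure L) (g : (p : Σ s, M.Dom s) → P.Dom p.1),
          ψ.Realize P (fun a => g ⟨σ a, u a⟩) →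
          ∃ g' : (p : Σ s, M.Dom s) → P.Dom p.1, (∀ a, g' ⟨σ a, u a⟩ = g ⟨σ a, u a⟩) ∧
            ∀ f ∈ Φ, f.HoldsAt P (fun s x => g' ⟨s, x⟩) := by
  classical
  induction l with
  | nil =>
    intro α σ u hc
    obtain ⟨ψ, hψ⟩ := exists_posForm_of_facts_of_range u Φ hne
      (fun f hf i => (hc f hf i).resolve_right (by simp))
    exact ⟨ψ, (hψ M fun p => p.2).2 hT, fun P g h => ⟨g, fun a => rfl, (hψ P g).1 h⟩⟩
  | cons q l ih =>
    intro α σ u hc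
    by_cases hq : q ∈ Set.range fun a => (⟨σ a, u a⟩ : Σ s, M.Dom s)
    · refine ih u fun f hf i => ?_
      rcases hc f hf i with h | h
      · exact .inl h
      · rcases List.mem_cons.1 h with h | h
        · exact .inl (h ▸ hq)
        · exact .inr h
    · obtain ⟨s, x⟩ := q
      obtain ⟨ψ, hψ, H⟩ := ih (σ := osort s σ) (vcons x u) (fun f hf i => by
        rcases hc f hf i with ⟨a, h⟩ | h
        · exact .inl ⟨some a, h⟩
        · rcases List.mem_cons.1 h with h | h
          · exact .inl ⟨none, h.symm⟩
          · exact .inr h)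
      refine ⟨.ex s ψ, ⟨x, hψ⟩, ?_⟩
      rintro P g ⟨z, hz⟩
      have hu : ∀ a, Function.update g ⟨s, x⟩ z ⟨σ a, u a⟩ = g ⟨σ a, u a⟩ := fun a =>
        Function.update_of_ne (fun e => hq ⟨a, e⟩) _ _
      have e : (fun o => Function.update g ⟨s, x⟩ z ⟨osort s σ o, vcons x u o⟩) =
          vcons z (fun a => g ⟨σ a, u a⟩) := by
        funext o
        cases o with
        | none => exact Function.update_self _ _ _
        | some a => exact hu a
      obtain ⟨g', hg', hΦ⟩ := H P (Function.update g ⟨s, x⟩ z) (e ▸ hz)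
      exact ⟨g', fun a => (hg' (some a)).trans (hu a), hΦ⟩

/-- A positive embedding has retractions of finitely many facts fixing all of its source. -/
theorem LHom.IsPosEmbedding.exists_retraction {M N : LStructure L} {f : LHom M N}
    (hf : f.IsPosEmbedding) (hM : IsLocal M) (hN : IsLocal N) (Φ : Set (AtomFact L N.Dom))
    (hΦ : Φ.Finite) (hT : ∀ φ ∈ Φ, φ.Holds) :
    ∃ g : ∀ s, N.Dom s → M.Dom s, (∀ φ ∈ Φ, φ.HoldsAt M g) ∧
      ∀ s x, g s (f.toFun s x) = x := by
  classical
  have : ∀ p : Σ s, N.Dom s, ∃ y : M.Dom p.1, ∀ x, p.2 = f.toFun p.1 x → y = x := by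
    rintro ⟨s, n⟩
    by_cases h : ∃ x, n = f.toFun s x
    · obtain ⟨x, rfl⟩ := h
      exact ⟨x, fun x' h => hf.injective hM hN s h⟩
    · obtain ⟨y⟩ := hf.nonempty hN n
      exact ⟨y, fun x hx => absurd ⟨x, hx⟩ h⟩
  choose g hg using this
  by_cases hne : hΦ.toFinset.toList = []
  · refine ⟨fun s x => g ⟨s, x⟩, fun φ hφ => ?_, fun s x => hg ⟨s, _⟩ x rfl⟩
    have : φ ∈ hΦ.toFinset.toList := by simpa using hφ
    simp [hne] at this
  · obtain ⟨ψ, hψ, H⟩ := exists_posForm_of_facts hΦ.toFinset.toList hne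
      (fun φ hφ => hT φ (by simpa using hφ))
      (hΦ.toFinset.toList.flatMap fun φ => List.ofFn fun i => ⟨_, φ.x i⟩)
      (σ := fun p : Σ s, M.Dom s => p.1) (fun p : Σ s, M.Dom s => f.toFun p.1 p.2)
      (fun φ hφ i => .inr (List.mem_flatMap.2 ⟨φ, hφ, List.mem_ofFn.2 ⟨i, rfl⟩⟩))
    have hψ' := hf _ _ ψ (fun p : Σ s, M.Dom s => p.2) hψ
    have e : (fun p : Σ s, M.Dom s => p.2) = fun p : Σ s, M.Dom s => g ⟨p.1, f.toFun p.1 p.2⟩ := by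
      funext p
      exact (hg ⟨p.1, _⟩ p.2 rfl).symm
    rw [e] at hψ'
    obtain ⟨g', hg', hg'Φ⟩ := H M g hψ'
    exact ⟨fun s x => g' ⟨s, x⟩, fun φ hφ => hg'Φ φ (by simpa using hφ),
      fun s x => (hg' ⟨s, x⟩).trans (hg ⟨s, _⟩ x rfl)⟩

end Facts

/-! ## Structures that are local up to the relation named by equality -/

section PreLocal

variable {L : LocalLanguage} {T : Set (PosSentence L)}

/-- A structure satisfying the locality axioms and `T`, in which the smallest locality
relation is only required to be a congruence. -/
structure IsPreLocal (M : LStructure L) (T : Set (PosSentence L)) : Prop where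
  refl : ∀ {s : L.Sorts} (a : M.Dom s), M.locRel (L.dd0 s) a a
  symm : ∀ {s : L.Sorts} (d : L.Loc s) (a b : M.Dom s), M.locRel d a b → M.locRel d b a
  mono : ∀ {s : L.Sorts} (d₁ d₂ : L.Loc s), L.locLe d₁ d₂ →
    ∀ (a b : M.Dom s), M.locRel d₁ a b → M.locRel d₂ a b
  comp : ∀ {s : L.Sorts} (d₁ d₂ : L.Loc s) (a b c : M.Dom s),
    M.locRel d₁ a b → M.locRel d₂ b c → M.locRel (L.locMul d₁ d₂) a c
  boundAx : ∀ {s : L.Sorts} (c₁ c₂ : L.Const s),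
    M.locRel (L.bound c₁ c₂) (M.constMap c₁) (M.constMap c₂)
  total : ∀ {s : L.Sorts} (a b : M.Dom s), ∃ d : L.Loc s, M.locRel d a b
  congr : ∀ {n : ℕ} {ρ : Fin n → L.Sorts} (R : L.Rel n ρ) (x y : (i : Fin n) → M.Dom (ρ i)),
    (∀ i, M.locRel (L.dd0 (ρ i)) (x i) (y i)) → M.relMap R x → M.relMap R y
  omits : ∀ φ ∈ T, ¬ φ.RealizedIn M

theorem IsPreLocal.localModel {M : LStructure L} (h : IsPreLocal M T)
    (hdd0 : ∀ {s : L.Sorts} (a b : M.Dom s), M.locRel (L.dd0 s) a b → a = b) :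
    LocalModel M T :=
  ⟨⟨h.symm, h.mono, h.comp, h.boundAx, h.total,
    fun a b => ⟨hdd0 a b, fun e => e ▸ h.refl a⟩⟩, h.omits⟩

/-- A structure with a relation-reflecting homomorphism to a local model is local up to the
relation named by equality. -/
theorem IsPreLocal.of_reflects {M N : LStructure L} (f : LHom M N)
    (hf : ∀ {n : ℕ} {ρ : Fin n → L.Sorts} (R : L.Rel n ρ) (x : (i : Fin n) → M.Dom (ρ i)),
      N.relMap R (fun i => f.toFun _ (x i)) → M.relMap R x)
    (hN : LocalModel N T) : IsPreLocal M T where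
  refl a := f.locRel_of_reflects hf _ ((hN.1.dd0_eq _ _).2 rfl)
  symm d a b h := f.locRel_of_reflects hf _ (hN.1.symm _ _ _ (f.map_locRel d h))
  mono d₁ d₂ h a b h' := f.locRel_of_reflects hf _ (hN.1.mono _ _ h _ _ (f.map_locRel _ h'))
  comp d₁ d₂ a b c h h' :=
    f.locRel_of_reflects hf _ (hN.1.comp _ _ _ _ _ (f.map_locRel _ h) (f.map_locRel _ h'))
  boundAx c₁ c₂ := f.locRel_of_reflects hf _ (by
    rw [f.map_const, f.map_const]
    exact hN.1.boundAx c₁ c₂)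
  total a b := by
    obtain ⟨d, hd⟩ := hN.1.total (f.toFun _ a) (f.toFun _ b)
    exact ⟨d, f.locRel_of_reflects hf _ hd⟩
  congr R x y h hx := by
    refine hf R y ?_
    have e : (fun i => f.toFun _ (y i)) = fun i => f.toFun _ (x i) := by
      funext i
      exact ((hN.1.dd0_eq _ _).1 (f.map_locRel _ (h i))).symm
    rw [e]
    exact f.map_rel R x hx
  omits φ hφ h := hN.2 φ hφ (f.realizedIn φ h)

theorem LHom.realize_of_reflects {M N : LStructure L} (f : LHom M N)
    (hf : ∀ {n : ℕ} {ρ : Fin n → L.Sorts} (R : L.Rel n ρ) (x : (i : Fin n) → M.Dom (ρ i)),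
      N.relMap R (fun i => f.toFun _ (x i)) → M.relMap R x)
    (hs : ∀ s, Function.Surjective (f.toFun s)) {α : Type} {σ : α → L.Sorts}
    (φ : PosForm L α σ) (v : (a : α) → M.Dom (σ a))
    (h : φ.Realize N fun a => f.toFun _ (v a)) : φ.Realize M v := by
  induction φ with
  | rel R ts =>
    simp only [PosForm.Realize, f.realize_term] at h ⊢
    exact hf _ _ h
  | and φ ψ ihφ ihψ => exact ⟨ihφ v h.1, ihψ v h.2⟩
  | or φ ψ ihφ ihψ => exact h.imp (ihφ v) (ihψ v)
  | ex s φ ih =>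
    obtain ⟨y, hy⟩ := h
    obtain ⟨x, rfl⟩ := hs s y
    rw [← map_vcons] at hy
    exact ⟨x, ih _ hy⟩

/-- Identification of points related by the smallest locality relation. -/
def IsPreLocal.setoid {M : LStructure L} (h : IsPreLocal M T) (s : L.Sorts) :
    Setoid (M.Dom s) where
  r := M.locRel (L.dd0 s)
  iseqv :=
    { refl := h.refl
      symm := fun {a b} => h.symm _ a b
      trans := fun {a b c} hab hbc => by
        have := h.comp _ _ a b c hab hbc
        rwa [L.dd0_locMul] at this }

/-- The quotient of a structure by the smallest locality relation. -/
def IsPreLocal.quot {M : LStructure L} (h : IsPreLocal M T) : LStructure L where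
  Dom s := Quotient (h.setoid s)
  relMap {n ρ} R x := ∃ y : (i : Fin n) → M.Dom (ρ i),
    (∀ i, Quotient.mk (h.setoid (ρ i)) (y i) = x i) ∧ M.relMap R y
  constMap {s} c := Quotient.mk (h.setoid s) (M.constMap c)

def IsPreLocal.toQuot {M : LStructure L} (h : IsPreLocal M T) : LHom M h.quot where
  toFun s := Quotient.mk (h.setoid s)
  map_rel _ x hx := ⟨x, fun _ => rfl, hx⟩
  map_const _ := rfl

theorem IsPreLocal.toQuot_surjective {M : LStructure L} (h : IsPreLocal M T) (s : L.Sorts) :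
    Function.Surjective (h.toQuot.toFun s) :=
  Quotient.mk_surjective

theorem IsPreLocal.toQuot_eq {M : LStructure L} (h : IsPreLocal M T) {s : L.Sorts}
    {a b : M.Dom s} (e : h.toQuot.toFun s a = h.toQuot.toFun s b) :
    M.locRel (L.dd0 s) a b :=
  Quotient.exact (s := h.setoid s) e

theorem IsPreLocal.toQuot_reflects {M : LStructure L} (h : IsPreLocal M T) {n : ℕ}
    {ρ : Fin n → L.Sorts} (R : L.Rel n ρ) (x : (i : Fin n) → M.Dom (ρ i))
    (hx : h.quot.relMap R (fun i => h.toQuot.toFun _ (x i))) : M.relMap R x := by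
  obtain ⟨y, hy, hR⟩ := hx
  exact h.congr R y x (fun i => h.toQuot_eq (hy i)) hR

theorem IsPreLocal.quot_localModel {M : LStructure L} (h : IsPreLocal M T) :
    LocalModel h.quot T := by
  have hs := h.toQuot_surjective
  have hr := fun {s : L.Sorts} (d : L.Loc s) {a b : M.Dom s} =>
    h.toQuot.locRel_of_reflects h.toQuot_reflects d (a := a) (b := b)
  refine ⟨⟨?_, ?_, ?_, ?_, ?_, ?_⟩, ?_⟩
  · intro s d a b hab
    obtain ⟨a, rfl⟩ := hs s a
    obtain ⟨b, rfl⟩ := hs s b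
    exact h.toQuot.map_locRel d (h.symm _ _ _ (hr d hab))
  · intro s d₁ d₂ hd a b hab
    obtain ⟨a, rfl⟩ := hs s a
    obtain ⟨b, rfl⟩ := hs s b
    exact h.toQuot.map_locRel _ (h.mono _ _ hd _ _ (hr _ hab))
  · intro s d₁ d₂ a b c hab hbc
    obtain ⟨a, rfl⟩ := hs s a
    obtain ⟨b, rfl⟩ := hs s b
    obtain ⟨c, rfl⟩ := hs s c
    exact h.toQuot.map_locRel _ (h.comp _ _ _ _ _ (hr _ hab) (hr _ hbc))
  · intro s c₁ c₂
    exact h.toQuot.map_locRel _ (h.boundAx c₁ c₂)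
  · intro s a b
    obtain ⟨a, rfl⟩ := hs s a
    obtain ⟨b, rfl⟩ := hs s b
    obtain ⟨d, hd⟩ := h.total a b
    exact ⟨d, h.toQuot.map_locRel d hd⟩
  · intro s a b
    obtain ⟨a, rfl⟩ := hs s a
    obtain ⟨b, rfl⟩ := hs s b
    refine ⟨fun hab => Quotient.sound (s := h.setoid s) (hr _ hab), fun e => ?_⟩
    exact h.toQuot.map_locRel _ (h.toQuot_eq e)
  · intro φ hφ hq
    refine h.omits φ hφ (h.toQuot.realize_of_reflects h.toQuot_reflects hs φ _ ?_)
    have e : (fun a : Empty => h.toQuot.toFun (emptySorts L a) (a.elim)) = fun a => a.elim :=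
      funext fun a => a.elim
    rw [e]
    exact hq

end PreLocal

/-! ## Amalgamation over a positive embedding -/

section Amalgamation

variable {L : LocalLanguage} {T : Set (PosSentence L)}

/-- The reduced power of a local structure, restricted to points that are eventually within
a fixed locality relation of a constant point. -/
def IsLocal.boundedPower {N : LStructure L} (hN : IsLocal N) {I : Type} (l : Filter I) :
    LStructure L where
  Dom s := {p : I → N.Dom s // ∃ (d : L.Loc s) (n : N.Dom s), ∀ᶠ i in l, N.locRel d (p i) n}
  relMap R x := ∀ᶠ i in l, N.relMap R fun j => (x j).1 i
  constMap {s} c := ⟨fun _ => N.constMap c, L.dd0 s, N.constMap c,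
    Filter.Eventually.of_forall fun _ => (hN.dd0_eq _ _).2 rfl⟩

theorem IsLocal.boundedPower_locRel {N : LStructure L} (hN : IsLocal N) {I : Type}
    (l : Filter I) {s : L.Sorts} (d : L.Loc s) (p q : (hN.boundedPower l).Dom s) :
    (hN.boundedPower l).locRel d p q ↔ ∀ᶠ i in l, N.locRel d (p.1 i) (q.1 i) := by
  refine Filter.eventually_congr (Filter.Eventually.of_forall fun i => ?_)
  rw [map_dpair (X := (hN.boundedPower l).Dom) (fun _ p => p.1 i) p q]
  rfl

theorem IsLocal.boundedPower_realize {N : LStructure L} (hN : IsLocal N) {I : Type}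
    (l : Filter I) {α : Type} {σ : α → L.Sorts} (φ : PosForm L α σ)
    (v : (a : α) → (hN.boundedPower l).Dom (σ a)) (h : φ.Realize (hN.boundedPower l) v) :
    ∀ᶠ i in l, φ.Realize N fun a => (v a).1 i := by
  induction φ with
  | rel R ts =>
    refine Filter.Eventually.mono h fun i hi => ?_
    have e : ∀ {s} (t : LTerm L _ _ s), (t.realize (hN.boundedPower l) v).1 i =
        t.realize N fun a => (v a).1 i := by
      intro s t
      cases t <;> rfl
    simp only [e] at hi
    exact hi
  | and φ ψ ihφ ihψ => exact (ihφ v h.1).and (ihψ v h.2)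
  | or φ ψ ihφ ihψ =>
    rcases h with h | h
    · exact (ihφ v h).mono fun _ => .inl
    · exact (ihψ v h).mono fun _ => .inr
  | ex s φ ih =>
    obtain ⟨x, hx⟩ := h
    refine (ih _ hx).mono fun i hi => ⟨x.1 i, ?_⟩
    convert hi using 1
    funext o
    cases o <;> rfl

theorem LocalModel.boundedPower_isPreLocal {N : LStructure L} (hN : LocalModel N T) {I : Type}
    (l : Filter I) [l.NeBot] : IsPreLocal (hN.1.boundedPower l) T where
  refl a := (hN.1.boundedPower_locRel l _ _ _).2
    (Filter.Eventually.of_forall fun _ => (hN.1.dd0_eq _ _).2 rfl)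
  symm d a b h := by
    rw [hN.1.boundedPower_locRel] at h ⊢
    exact h.mono fun _ => hN.1.symm _ _ _
  mono d₁ d₂ hd a b h := by
    rw [hN.1.boundedPower_locRel] at h ⊢
    exact h.mono fun _ => hN.1.mono _ _ hd _ _
  comp d₁ d₂ a b c h h' := by
    rw [hN.1.boundedPower_locRel] at h h' ⊢
    exact (h.and h').mono fun _ h => hN.1.comp _ _ _ _ _ h.1 h.2
  boundAx c₁ c₂ := (hN.1.boundedPower_locRel l _ _ _).2
    (Filter.Eventually.of_forall fun _ => hN.1.boundAx c₁ c₂)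
  total a b := by
    obtain ⟨d, n, hd⟩ := a.2
    obtain ⟨d', n', hd'⟩ := b.2
    obtain ⟨e, he⟩ := hN.1.total n n'
    refine ⟨_, (hN.1.boundedPower_locRel l _ a b).2 ((hd.and hd').mono fun i hi =>
      hN.1.comp _ _ _ _ _ (hN.1.comp _ _ _ _ _ hi.1 he) (hN.1.symm _ _ _ hi.2))⟩
  congr R x y h hx := by
    have h' := Filter.eventually_all.2 fun i => (hN.1.boundedPower_locRel l _ _ _).1 (h i)
    refine (h'.and hx).mono fun i hi => ?_
    have e : (fun j => (y j).1 i) = fun j => (x j).1 i := by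
      funext j
      exact ((hN.1.dd0_eq _ _).1 (hi.1 j)).symm
    rw [e]
    exact hi.2
  omits φ hφ h := by
    obtain ⟨i, hi⟩ := (hN.1.boundedPower_realize l φ _ h).exists
    exact hN.2 φ hφ (PosSentence.realizedIn_of_realize φ _ hi)

theorem LHom.IsPosEmbedding.amalgamate {A M N : LStructure L} {f : LHom A M}
    (hf : f.IsPosEmbedding) (hA : IsLocal A) (hM : IsLocal M) (hN : LocalModel N T)
    (g : LHom A N) :
    ∃ P : LStructure L, LocalModel P T ∧ ∃ (h : LHom M P) (k : LHom N P),
      h.comp f = k.comp g := by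
  classical
  have hr := fun Φ : Finset {φ : AtomFact L M.Dom // φ.Holds} =>
    hf.exists_retraction hA hM (Subtype.val '' (Φ : Set {φ : AtomFact L M.Dom // φ.Holds}))
      (Φ.finite_toSet.image _) (by
        rintro _ ⟨φ, -, rfl⟩
        exact φ.2)
  choose r hr hrf using hr
  have hev : ∀ {n : ℕ} {ρ : Fin n → L.Sorts} (R : L.Rel n ρ) (x : (i : Fin n) → M.Dom (ρ i)),
      M.relMap R x → ∀ᶠ Φ in Filter.atTop,
        N.relMap R fun i => g.toFun _ (r Φ _ (x i)) := by
    intro n ρ R x hx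
    refine (Filter.eventually_ge_atTop {⟨⟨n, ρ, R, x⟩, hx⟩}).mono fun Φ hΦ => ?_
    exact g.map_rel _ _ (hr Φ ⟨n, ρ, R, x⟩
      ⟨⟨⟨n, ρ, R, x⟩, hx⟩, hΦ (Finset.mem_singleton_self _), rfl⟩)
  have hP := hN.boundedPower_isPreLocal
    (Filter.atTop : Filter (Finset {φ : AtomFact L M.Dom // φ.Holds}))
  let k : LHom N (hN.1.boundedPower
      (Filter.atTop : Filter (Finset {φ : AtomFact L M.Dom // φ.Holds}))) :=
    { toFun := fun s n => ⟨fun _ => n, L.dd0 s, n,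
        Filter.Eventually.of_forall fun _ => (hN.1.dd0_eq _ _).2 rfl⟩
      map_rel := fun R x hx => Filter.Eventually.of_forall fun _ => hx
      map_const := fun c => rfl }
  let h : LHom M (hN.1.boundedPower
      (Filter.atTop : Filter (Finset {φ : AtomFact L M.Dom // φ.Holds}))) :=
    { toFun := fun s m => ⟨fun Φ => g.toFun s (r Φ s m), by
        obtain ⟨a⟩ := hf.nonempty hM m
        obtain ⟨d, hd⟩ := hM.total m (f.toFun s a)
        refine ⟨d, g.toFun s a, (hev _ _ hd).mono fun Φ hΦ => ?_⟩
        have e := map_dpair (X := M.Dom) (fun s m => g.toFun s (r Φ s m)) m (f.toFun s a)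
        rw [hrf] at e
        rw [e] at hΦ
        exact hΦ⟩
      map_rel := fun R x hx => hev R x hx
      map_const := fun c => by
        refine Subtype.ext (funext fun Φ => ?_)
        change g.toFun _ (r Φ _ (M.constMap c)) = N.constMap c
        rw [← f.map_const, hrf, g.map_const] }
  refine ⟨hP.quot, hP.quot_localModel, hP.toQuot.comp h, hP.toQuot.comp k, LHom.ext ?_⟩
  intro s x
  change hP.toQuot.toFun s (h.toFun s (f.toFun s x)) =
    hP.toQuot.toFun s (k.toFun s (g.toFun s x))
  congr 1
  refine Subtype.ext (funext fun Φ => ?_)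
  change g.toFun _ (r Φ _ (f.toFun s x)) = _
  rw [hrf]

theorem Compat.symm {A B : LStructure L} (h : Compat T A B) : Compat T B A := by
  obtain ⟨M, hM, a, b⟩ := h
  exact ⟨M, hM, b, a⟩

/-- Compatibility is transitive through positively closed models. -/
theorem IsPC.compat_trans {A M N : LStructure L} (hA : IsPC A T) (hM : Compat T A M)
    (hN : Compat T A N) : Compat T M N := by
  obtain ⟨M', hM', ⟨f⟩, ⟨m⟩⟩ := hM
  obtain ⟨N', hN', ⟨g⟩, ⟨n⟩⟩ := hN
  obtain ⟨P, hP, h, k, -⟩ := (hA.2 M' f hM').amalgamate hA.1.1 hM'.1 hN' g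
  exact ⟨P, hP, ⟨h.comp m⟩, ⟨k.comp n⟩⟩

theorem IsPC.compat_of_hom {A M N : LStructure L} (hA : IsPC A T) (hM : Compat T A M)
    (f : LHom A N) (hN : LocalModel N T) : Compat T M N :=
  hA.compat_trans hM ⟨N, hN, ⟨f⟩, ⟨LHom.id N⟩⟩

end Amalgamation

/-! ## Structures presented by sets of atomic facts -/

section Diagrams

variable {L : LocalLanguage} {T : Set (PosSentence L)} {X : L.Sorts → Type}
  {k : ∀ s, L.Const s → X s}

def locFact {s : L.Sorts} (d : L.Loc s) (a b : X s) : AtomFact L X :=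
  ⟨2, ![s, s], L.locToRel d, dpair a b⟩

/-- The points about which a set of facts asserts self-identity. -/
def factDom (F : Set (AtomFact L X)) (s : L.Sorts) : Set (X s) :=
  {x | locFact (L.dd0 s) x x ∈ F}

theorem factDom_mono {F F' : Set (AtomFact L X)} (h : F ⊆ F') (s : L.Sorts) :
    factDom F s ⊆ factDom F' s :=
  fun _ hx => h hx

/-- The structure whose true facts are the members of `F`. -/
def factStruct (F : Set (AtomFact L X)) (hk : ∀ s c, k s c ∈ factDom F s) : LStructure L where
  Dom s := factDom F s
  relMap {n ρ} R x := (⟨n, ρ, R, fun i => (x i).1⟩ : AtomFact L X) ∈ F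
  constMap {s} c := ⟨k s c, hk s c⟩

theorem factStruct_locRel {F : Set (AtomFact L X)} {hk : ∀ s c, k s c ∈ factDom F s}
    {s : L.Sorts} {d : L.Loc s} {a b : (factStruct F hk).Dom s} :
    (factStruct F hk).locRel d a b ↔ locFact d a.1 b.1 ∈ F := by
  change (⟨2, ![s, s], L.locToRel d, _⟩ : AtomFact L X) ∈ F ↔ _
  rw [map_dpair (X := (factStruct F hk).Dom) (fun _ x => x.1) a b]
  rfl

def factStruct.incl {F F' : Set (AtomFact L X)} (h : F ⊆ F')
    (hk : ∀ s c, k s c ∈ factDom F s) (hk' : ∀ s c, k s c ∈ factDom F' s) :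
    LHom (factStruct F hk) (factStruct F' hk') where
  toFun s x := ⟨x.1, factDom_mono h s x.2⟩
  map_rel _ _ hx := h hx
  map_const _ := rfl

/-- `F` presents a structure that is local up to the relation named by equality. -/
structure IsDiagram (T : Set (PosSentence L)) (k : ∀ s, L.Const s → X s)
    (F : Set (AtomFact L X)) : Prop where
  const_mem : ∀ s c, k s c ∈ factDom F s
  support : ∀ f ∈ F, ∀ i, f.x i ∈ factDom F (f.ρ i)
  isPreLocal : IsPreLocal (factStruct F const_mem) T

theorem IsDiagram.left_mem {F : Set (AtomFact L X)} (h : IsDiagram T k F) {s : L.Sorts}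
    {d : L.Loc s} {a b : X s} (hf : locFact d a b ∈ F) : a ∈ factDom F s :=
  h.support _ hf (0 : Fin 2)

theorem IsDiagram.right_mem {F : Set (AtomFact L X)} (h : IsDiagram T k F) {s : L.Sorts}
    {d : L.Loc s} {a b : X s} (hf : locFact d a b ∈ F) : b ∈ factDom F s :=
  h.support _ hf (1 : Fin 2)

theorem LTerm.realize_factStruct {F F' : Set (AtomFact L X)} {hk : ∀ s c, k s c ∈ factDom F s}
    {hk' : ∀ s c, k s c ∈ factDom F' s} {α : Type} {σ : α → L.Sorts}
    {v : (a : α) → (factStruct F hk).Dom (σ a)} {v' : (a : α) → (factStruct F' hk').Dom (σ a)}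
    (h : ∀ a, (v' a).1 = (v a).1) {s : L.Sorts} (t : LTerm L α σ s) :
    (t.realize (factStruct F' hk') v').1 = (t.realize (factStruct F hk) v).1 := by
  cases t with
  | var a => exact h a
  | const c => rfl

theorem PosForm.realize_sUnion {c : Set (Set (AtomFact L X))} (hc : IsChain (· ⊆ ·) c)
    (hk : ∀ s x, k s x ∈ factDom (⋃₀ c) s) {α : Type} {σ : α → L.Sorts} (φ : PosForm L α σ)
    (v : (a : α) → (factStruct (⋃₀ c) hk).Dom (σ a))
    (h : φ.Realize (factStruct (⋃₀ c) hk) v) :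
    ∃ F ∈ c, ∀ F' ∈ c, F ⊆ F' → ∀ (hk' : ∀ s x, k s x ∈ factDom F' s)
      (v' : (a : α) → (factStruct F' hk').Dom (σ a)), (∀ a, (v' a).1 = (v a).1) →
        φ.Realize (factStruct F' hk') v' := by
  induction φ with
  | @rel α σ n ρ R ts =>
    obtain ⟨F, hF, hR⟩ := h
    refine ⟨F, hF, fun F' hF' hFF' hk' v' hv' => hFF' ?_⟩
    have e : (fun i => ((ts i).realize (factStruct F' hk') v').1) =
        fun i => ((ts i).realize (factStruct (⋃₀ c) hk) v).1 :=
      funext fun i => (ts i).realize_factStruct hv'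
    rw [e]
    exact hR
  | and φ ψ ihφ ihψ =>
    obtain ⟨F₁, h₁, H₁⟩ := ihφ v h.1
    obtain ⟨F₂, h₂, H₂⟩ := ihψ v h.2
    obtain ⟨F, hF, hF₁, hF₂⟩ := hc.directedOn F₁ h₁ F₂ h₂
    exact ⟨F, hF, fun F' hF' hFF' hk' v' hv' =>
      ⟨H₁ F' hF' (hF₁.trans hFF') hk' v' hv', H₂ F' hF' (hF₂.trans hFF') hk' v' hv'⟩⟩
  | or φ ψ ihφ ihψ =>
    rcases h with h | h
    · obtain ⟨F, hF, H⟩ := ihφ v h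
      exact ⟨F, hF, fun F' hF' hFF' hk' v' hv' => .inl (H F' hF' hFF' hk' v' hv')⟩
    · obtain ⟨F, hF, H⟩ := ihψ v h
      exact ⟨F, hF, fun F' hF' hFF' hk' v' hv' => .inr (H F' hF' hFF' hk' v' hv')⟩
  | ex s φ ih =>
    obtain ⟨x, hx⟩ := h
    obtain ⟨F₁, h₁, H₁⟩ := ih _ hx
    obtain ⟨F₂, h₂, hxF⟩ := x.2
    obtain ⟨F, hF, hF₁, hF₂⟩ := hc.directedOn F₁ h₁ F₂ h₂
    refine ⟨F, hF, fun F' hF' hFF' hk' v' hv' =>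
      ⟨⟨x.1, hFF' (hF₂ hxF)⟩, H₁ F' hF' (hF₁.trans hFF') hk' _ ?_⟩⟩
    rintro (_ | a)
    · rfl
    · exact hv' a

theorem IsDiagram.sUnion {c : Set (Set (AtomFact L X))} (hc : IsChain (· ⊆ ·) c)
    (hne : c.Nonempty) (h : ∀ F ∈ c, IsDiagram T k F) : IsDiagram T k (⋃₀ c) := by
  have hfin : ∀ S : Set (AtomFact L X), S.Finite → S ⊆ ⋃₀ c → ∃ F ∈ c, S ⊆ F := fun S hS hSc =>
    DirectedOn.exists_mem_subset_of_finite_of_subset_sUnion hne hc.directedOn hS hSc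
  have hk : ∀ s x, k s x ∈ factDom (⋃₀ c) s := by
    obtain ⟨F, hF⟩ := hne
    exact fun s x => ⟨F, hF, (h F hF).const_mem s x⟩
  refine ⟨hk, ?_, ?_, ?_, ?_, ?_, ?_, ?_, ?_, ?_⟩
  · rintro f ⟨F, hF, hf⟩ i
    exact ⟨F, hF, (h F hF).support f hf i⟩
  · intro s a
    exact factStruct_locRel.2 a.2
  · intro s d a b hab
    obtain ⟨F, hF, hab⟩ := factStruct_locRel.1 hab
    exact factStruct_locRel.2 ⟨F, hF, factStruct_locRel.1 ((h F hF).isPreLocal.symm d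
      ⟨_, (h F hF).left_mem hab⟩ ⟨_, (h F hF).right_mem hab⟩ (factStruct_locRel.2 hab))⟩
  · intro s d₁ d₂ hd a b hab
    obtain ⟨F, hF, hab⟩ := factStruct_locRel.1 hab
    exact factStruct_locRel.2 ⟨F, hF, factStruct_locRel.1 ((h F hF).isPreLocal.mono d₁ d₂ hd
      ⟨_, (h F hF).left_mem hab⟩ ⟨_, (h F hF).right_mem hab⟩ (factStruct_locRel.2 hab))⟩
  · intro s d₁ d₂ a b e hab hbe
    obtain ⟨F, hF, hS⟩ := hfin {locFact d₁ a.1 b.1, locFact d₂ b.1 e.1} (by simp)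
      (Set.insert_subset (factStruct_locRel.1 hab)
        (Set.singleton_subset_iff.2 (factStruct_locRel.1 hbe)))
    have hab := hS (.inl rfl)
    have hbe := hS (.inr rfl)
    exact factStruct_locRel.2 ⟨F, hF, factStruct_locRel.1 ((h F hF).isPreLocal.comp d₁ d₂
      ⟨_, (h F hF).left_mem hab⟩ ⟨_, (h F hF).right_mem hab⟩ ⟨_, (h F hF).right_mem hbe⟩
      (factStruct_locRel.2 hab) (factStruct_locRel.2 hbe))⟩
  · intro s c₁ c₂
    obtain ⟨F, hF⟩ := hne
    exact factStruct_locRel.2 ⟨F, hF, factStruct_locRel.1 ((h F hF).isPreLocal.boundAx c₁ c₂)⟩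
  · intro s a b
    obtain ⟨F, hF, hS⟩ := hfin {locFact (L.dd0 s) a.1 a.1, locFact (L.dd0 s) b.1 b.1} (by simp)
      (Set.insert_subset a.2 (Set.singleton_subset_iff.2 b.2))
    obtain ⟨d, hd⟩ := (h F hF).isPreLocal.total ⟨a.1, hS (.inl rfl)⟩ ⟨b.1, hS (.inr rfl)⟩
    exact ⟨d, factStruct_locRel.2 ⟨F, hF, factStruct_locRel.1 hd⟩⟩
  · intro n ρ R x y hxy hx
    obtain ⟨F, hF, hS⟩ := hfin
      (insert ⟨n, ρ, R, fun i => (x i).1⟩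
        (Set.range fun i => locFact (L.dd0 (ρ i)) (x i).1 (y i).1))
      ((Set.finite_range _).insert _)
      (Set.insert_subset hx (by
        rintro _ ⟨i, rfl⟩
        exact factStruct_locRel.1 (hxy i)))
    have hxy' := fun i => hS (.inr ⟨i, rfl⟩)
    exact ⟨F, hF, (h F hF).isPreLocal.congr R
      (fun i => ⟨_, (h F hF).left_mem (hxy' i)⟩) (fun i => ⟨_, (h F hF).right_mem (hxy' i)⟩)
      (fun i => factStruct_locRel.2 (hxy' i)) (hS (.inl rfl))⟩
  · intro φ hφ hU
    obtain ⟨F, hF, H⟩ := PosForm.realize_sUnion hc hk φ _ hU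
    exact (h F hF).isPreLocal.omits φ hφ (H F hF subset_rfl (h F hF).const_mem _ fun a => a.elim)

/-- A property of diagrams preserved under unions of chains has maximal instances. -/
theorem exists_maximal_diagram (Q : Set (AtomFact L X) → Prop)
    (hQ : ∀ c : Set (Set (AtomFact L X)), IsChain (· ⊆ ·) c → c.Nonempty →
      (∀ F ∈ c, IsDiagram T k F ∧ Q F) → Q (⋃₀ c))
    (F₀ : Set (AtomFact L X)) (h₀ : IsDiagram T k F₀) (hQ₀ : Q F₀) :
    ∃ F, F₀ ⊆ F ∧ IsDiagram T k F ∧ Q F ∧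
      ∀ F', IsDiagram T k F' → Q F' → F ⊆ F' → F' ⊆ F := by
  obtain ⟨F, hF₀, hF⟩ := zorn_subset_nonempty {F | IsDiagram T k F ∧ Q F}
    (fun c hc hch hne => ⟨⋃₀ c, ⟨IsDiagram.sUnion hch hne fun F hF => (hc hF).1,
      hQ c hch hne fun F hF => hc hF⟩, fun F hF => Set.subset_sUnion_of_mem hF⟩) F₀ ⟨h₀, hQ₀⟩
  exact ⟨F, hF₀, hF.1.1, hF.1.2, fun F' h h' hFF' => hF.2 ⟨h, h'⟩ hFF'⟩

/-- The facts that become true in `N` under the correspondence `Gr`. -/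
def pullFacts (N : LStructure L) (Gr : ∀ s, X s → N.Dom s → Prop) : Set (AtomFact L X) :=
  {f | ∃ z : (i : Fin f.n) → N.Dom (f.ρ i), (∀ i, Gr _ (f.x i) (z i)) ∧ N.relMap f.R z}

section Pull

variable {N : LStructure L} {Gr : ∀ s, X s → N.Dom s → Prop}

theorem mem_pullFacts (hGr : ∀ s x n n', Gr s x n → Gr s x n' → n = n') {f : AtomFact L X}
    {z : (i : Fin f.n) → N.Dom (f.ρ i)} (hz : ∀ i, Gr _ (f.x i) (z i)) :
    f ∈ pullFacts N Gr ↔ N.relMap f.R z := by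
  refine ⟨?_, fun h => ⟨z, hz, h⟩⟩
  rintro ⟨z', hz', h⟩
  have e : z = z' := funext fun i => hGr _ _ _ _ (hz i) (hz' i)
  rwa [e]

theorem mem_factDom_pullFacts (hN : IsLocal N) {s : L.Sorts} {x : X s} :
    x ∈ factDom (pullFacts N Gr) s ↔ ∃ n, Gr s x n := by
  constructor
  · rintro ⟨z, hz, -⟩
    exact ⟨z (0 : Fin 2), hz (0 : Fin 2)⟩
  · rintro ⟨n, hn⟩
    refine ⟨(dpair n n : (i : Fin 2) → N.Dom (![s, s] i)), ?_, (hN.dd0_eq n n).2 rfl⟩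
    intro i
    match i with
    | ⟨0, _⟩ => exact hn
    | ⟨1, _⟩ => exact hn

/-- The structure presented by the pulled back facts maps to `N`, reflecting relations. -/
theorem exists_hom_pullFacts (hGr : ∀ s x n n', Gr s x n → Gr s x n' → n = n')
    (hk : ∀ s c, Gr s (k s c) (N.constMap c)) (hN : IsLocal N)
    (hk' : ∀ s c, k s c ∈ factDom (pullFacts N Gr) s) :
    ∃ g : LHom (factStruct (pullFacts N Gr) hk') N,
      (∀ s x, Gr s x.1 (g.toFun s x)) ∧
      ∀ {n : ℕ} {ρ : Fin n → L.Sorts} (R : L.Rel n ρ)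
        (x : (i : Fin n) → (factStruct (pullFacts N Gr) hk').Dom (ρ i)),
        N.relMap R (fun i => g.toFun _ (x i)) → (factStruct (pullFacts N Gr) hk').relMap R x := by
  choose g hg using fun (s : L.Sorts) (x : factDom (pullFacts N Gr) s) =>
    (mem_factDom_pullFacts hN).1 x.2
  exact ⟨⟨g, fun R x hx => (mem_pullFacts hGr fun i => hg _ (x i)).1 hx,
    fun {s} c => hGr _ _ _ _ (hg _ _) (hk s c)⟩, hg, fun R x hx =>
      (mem_pullFacts hGr fun i => hg _ (x i)).2 hx⟩

theorem isDiagram_pullFacts (hGr : ∀ s x n n', Gr s x n → Gr s x n' → n = n')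
    (hk : ∀ s c, Gr s (k s c) (N.constMap c)) (hN : LocalModel N T) :
    IsDiagram T k (pullFacts N Gr) := by
  have hk' : ∀ s c, k s c ∈ factDom (pullFacts N Gr) s := fun s c =>
    (mem_factDom_pullFacts hN.1).2 ⟨_, hk s c⟩
  obtain ⟨g, -, hg⟩ := exists_hom_pullFacts hGr hk hN.1 hk'
  refine ⟨hk', ?_, IsPreLocal.of_reflects g hg hN⟩
  rintro f ⟨z, hz, -⟩ i
  exact (mem_factDom_pullFacts hN.1).2 ⟨_, hz i⟩

end Pull

end Diagrams

/-! ## Extending a local model to a positively closed one -/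

section Closure

variable {L : LocalLanguage} {T : Set (PosSentence L)}

/-- The members of sort `s` of a pair of tuples of sorted variables. -/
def PairVar {n k : ℕ} (ρ : Fin n → L.Sorts) (τ : Fin k → L.Sorts) (s : L.Sorts) : Type :=
  {t : Fin n ⊕ Fin k // Sum.elim ρ τ t = s}

section PairVar

variable {n k : ℕ} {ρ : Fin n → L.Sorts} {τ : Fin k → L.Sorts} {Y Z : L.Sorts → Type}

def pairVal (a : ∀ i, Y (ρ i)) (b : ∀ j, Y (τ j)) {s : L.Sorts} : PairVar ρ τ s → Y s
  | ⟨.inl i, h⟩ => h ▸ a i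
  | ⟨.inr j, h⟩ => h ▸ b j

def PairVar.inl (τ : Fin k → L.Sorts) (i : Fin n) : PairVar ρ τ (ρ i) :=
  ⟨.inl i, rfl⟩

def PairVar.inr (ρ : Fin n → L.Sorts) (j : Fin k) : PairVar ρ τ (τ j) :=
  ⟨.inr j, rfl⟩

theorem PairVar.cases {motive : ∀ s, PairVar ρ τ s → Prop}
    (inl : ∀ i, motive _ (PairVar.inl τ i)) (inr : ∀ j, motive _ (PairVar.inr ρ j))
    {s : L.Sorts} (t : PairVar ρ τ s) : motive s t := by
  obtain ⟨i | j, rfl⟩ := t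
  exacts [inl i, inr j]

theorem map_pairVal (g : ∀ s, Y s → Z s) (a : ∀ i, Y (ρ i)) (b : ∀ j, Y (τ j)) {s : L.Sorts}
    (t : PairVar ρ τ s) :
    g s (pairVal a b t) = pairVal (fun i => g _ (a i)) (fun j => g _ (b j)) t :=
  t.cases (motive := fun s t =>
    g s (pairVal a b t) = pairVal (fun i => g _ (a i)) (fun j => g _ (b j)) t)
    (fun _ => rfl) (fun _ => rfl)

end PairVar

/-- Points of a structure `M`, closed under formal witnesses for sets of facts about finitely
many points and finitely many unknowns. -/
inductive WitPoint (M : LStructure L) : L.Sorts → Type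
  | base {s : L.Sorts} (m : M.Dom s) : WitPoint M s
  | wit {n k : ℕ} {ρ : Fin n → L.Sorts} {τ : Fin k → L.Sorts}
      (par : (i : Fin n) → WitPoint M (ρ i)) (Θ : Set (AtomFact L (PairVar ρ τ)))
      (j : Fin k) : WitPoint M (τ j)

/-- A system of facts with parameters, to be solved by witnesses. -/
structure WitSystem (M : LStructure L) where
  n : ℕ
  k : ℕ
  ρ : Fin n → L.Sorts
  τ : Fin k → L.Sorts
  par : (i : Fin n) → WitPoint M (ρ i)
  Θ : Set (AtomFact L (PairVar ρ τ))

variable {M : LStructure L}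

def WitSystem.wit (D : WitSystem M) (j : Fin D.k) : WitPoint M (D.τ j) :=
  .wit D.par D.Θ j

def WitPoint.system : {s : L.Sorts} → WitPoint M s → Option (Σ D : WitSystem M, Fin D.k)
  | _, .base _ => none
  | _, @WitPoint.wit _ _ n k ρ τ par Θ j => some ⟨⟨n, k, ρ, τ, par, Θ⟩, j⟩

theorem WitSystem.wit_ne_base (D : WitSystem M) (j : Fin D.k) (m : M.Dom (D.τ j)) :
    D.wit j ≠ .base m := fun h => by
  have h' := congrArg WitPoint.system h
  exact Option.some_ne_none _ h'

theorem WitSystem.wit_injective {D D' : WitSystem M} {j : Fin D.k} {j' : Fin D'.k}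
    (h : (⟨_, D.wit j⟩ : Σ s, WitPoint M s) = ⟨_, D'.wit j'⟩) :
    (⟨D, j⟩ : Σ D : WitSystem M, Fin D.k) = ⟨D', j'⟩ := by
  have h' := congrArg (fun p : Σ s, WitPoint M s => p.2.system) h
  exact Option.some_injective _ h'

/-- The fact `f` of a system, evaluated at the witnesses. -/
def WitSystem.fact (D : WitSystem M) (f : AtomFact L (PairVar D.ρ D.τ)) :
    AtomFact L (WitPoint M) :=
  ⟨f.n, f.ρ, f.R, fun i => pairVal D.par D.wit (f.x i)⟩

/-- Every witness in the domain of `F` solves its system. -/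
def WitnessesSolve (F : Set (AtomFact L (WitPoint M))) : Prop :=
  ∀ (D : WitSystem M) (j : Fin D.k), D.wit j ∈ factDom F (D.τ j) → ∀ f ∈ D.Θ, D.fact f ∈ F

def WitPoint.const (M : LStructure L) (s : L.Sorts) (c : L.Const s) : WitPoint M s :=
  .base (M.constMap c)

/-- In a maximal diagram whose witnesses solve their systems, every finite system solvable
over a homomorphic image in a local model is solvable. -/
theorem exists_solution {F : Set (AtomFact L (WitPoint M))}
    (hF : IsDiagram T (WitPoint.const M) F) (hQ : WitnessesSolve F)
    (hmax : ∀ F', IsDiagram T (WitPoint.const M) F' → WitnessesSolve F' → F ⊆ F' → F' ⊆ F)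
    {N : LStructure L} (hN : LocalModel N T) (r : LHom (factStruct F hF.const_mem) N)
    {n k : ℕ} {ρ : Fin n → L.Sorts} {τ : Fin k → L.Sorts}
    (y : (i : Fin n) → (factStruct F hF.const_mem).Dom (ρ i)) (w : (j : Fin k) → N.Dom (τ j)) :
    ∃ b : (j : Fin k) → (factStruct F hF.const_mem).Dom (τ j),
      ∀ {m : ℕ} {π : Fin m → L.Sorts} (R : L.Rel m π) (x : (i : Fin m) → PairVar ρ τ (π i)),
        N.relMap R (fun i => pairVal (fun i => r.toFun _ (y i)) w (x i)) →
        (factStruct F hF.const_mem).relMap R (fun i => pairVal y b (x i)) := by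
  let D : WitSystem M := ⟨n, k, ρ, τ, fun i => (y i).1,
    {f | N.relMap f.R fun i => pairVal (fun i => r.toFun _ (y i)) w (f.x i)}⟩
  have key : ∀ f ∈ D.Θ, D.fact f ∈ F := by
    by_cases hD : ∃ j, D.wit j ∈ factDom F (D.τ j)
    · obtain ⟨j, hj⟩ := hD
      exact hQ D j hj
    let Gr : ∀ s, WitPoint M s → N.Dom s → Prop := fun s x m =>
      (∃ h : x ∈ factDom F s, r.toFun s ⟨x, h⟩ = m) ∨
        ∃ j, (⟨s, x, m⟩ : Σ s, WitPoint M s × N.Dom s) = ⟨τ j, D.wit j, w j⟩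
    have hold : ∀ s (x : (factStruct F hF.const_mem).Dom s), Gr s x.1 (r.toFun s x) :=
      fun s x => .inl ⟨x.2, rfl⟩
    have hnew : ∀ {s} (t : PairVar ρ τ s),
        Gr s (pairVal D.par D.wit t) (pairVal (fun i => r.toFun _ (y i)) w t) := fun t =>
      t.cases (motive := fun s t =>
        Gr s (pairVal D.par D.wit t) (pairVal (fun i => r.toFun _ (y i)) w t))
        (fun i => hold _ (y i)) (fun j => .inr ⟨j, rfl⟩)
    have hGr : ∀ s x m m', Gr s x m → Gr s x m' → m = m' := by
      have aux : ∀ s x m, Gr s x m → ∀ j, (⟨s, x, m⟩ : Σ s, WitPoint M s × N.Dom s) =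
          ⟨τ j, D.wit j, w j⟩ → x ∉ factDom F s := by
        intro s x m _ j h hx
        obtain ⟨rfl, h⟩ := Sigma.mk.inj_iff.1 h
        obtain ⟨rfl, -⟩ := Prod.mk_inj.1 (eq_of_heq h)
        exact hD ⟨j, hx⟩
      intro s x m m' h h'
      rcases h with ⟨hx, rfl⟩ | ⟨j, hj⟩
      · rcases h' with ⟨hx', rfl⟩ | ⟨j, hj⟩
        · rfl
        · exact absurd hx (aux _ _ _ (.inr ⟨j, hj⟩) j hj)
      · rcases h' with ⟨hx', rfl⟩ | ⟨j', hj'⟩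
        · exact absurd hx' (aux _ _ _ (.inr ⟨j, hj⟩) j hj)
        · have e := WitSystem.wit_injective (D := D) (D' := D) (j := j) (j' := j')
            ((congrArg (fun p : Σ s, WitPoint M s × N.Dom s =>
              (⟨p.1, p.2.1⟩ : Σ s, WitPoint M s)) hj).symm.trans
              (congrArg (fun p : Σ s, WitPoint M s × N.Dom s =>
                (⟨p.1, p.2.1⟩ : Σ s, WitPoint M s)) hj'))
          obtain rfl : j = j' := eq_of_heq (Sigma.mk.inj_iff.1 e).2
          have e' := hj.trans hj'.symm
          exact (Prod.mk_inj.1 (eq_of_heq (Sigma.mk.inj_iff.1 e').2)).2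
    have hsub : F ⊆ pullFacts N Gr := fun f hf =>
      ⟨fun i => r.toFun _ ⟨f.x i, hF.support f hf i⟩, fun i => hold _ ⟨f.x i, hF.support f hf i⟩,
        r.map_rel f.R _ hf⟩
    have hD' : ∀ f ∈ D.Θ, D.fact f ∈ pullFacts N Gr := fun f hf =>
      ⟨fun i => pairVal (fun i => r.toFun _ (y i)) w (f.x i), fun i => hnew (f.x i), hf⟩
    have hF' := isDiagram_pullFacts (T := T) hGr
      (fun s c => .inl ⟨hF.const_mem s c, r.map_const c⟩) hN
    refine fun f hf => hmax _ hF' ?_ hsub (hD' f hf)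
    intro D' j' hj'
    obtain ⟨m, ⟨h, -⟩ | ⟨j, hj⟩⟩ := (mem_factDom_pullFacts hN.1).1 hj'
    · exact fun f hf => hsub (hQ D' j' h f hf)
    · have e := WitSystem.wit_injective (D := D') (D' := D) (j := j') (j' := j)
        (congrArg (fun p : Σ s, WitPoint M s × N.Dom s =>
          (⟨p.1, p.2.1⟩ : Σ s, WitPoint M s)) hj)
      obtain rfl := (Sigma.mk.inj_iff.1 e).1
      exact hD'
  have hwit : ∀ j, D.wit j ∈ factDom F (τ j) := by
    intro j
    have h := key (locFact (L.dd0 (τ j)) (PairVar.inr ρ j) (PairVar.inr ρ j)) (by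
      change N.relMap _ _
      have e := map_dpair (X := PairVar ρ τ)
        (fun s t => pairVal (fun i => r.toFun _ (y i)) w t) (PairVar.inr ρ j) (PairVar.inr ρ j)
      erw [e]
      exact (hN.1.dd0_eq _ _).2 rfl)
    have e := map_dpair (X := PairVar ρ τ)
      (fun s t => pairVal D.par D.wit t) (PairVar.inr ρ j) (PairVar.inr ρ j)
    have e' : D.fact (locFact (L.dd0 (τ j)) (PairVar.inr ρ j) (PairVar.inr ρ j)) =
        locFact (L.dd0 (τ j)) (D.wit j) (D.wit j) :=
      congrArg (fun x => (⟨2, ![τ j, τ j], L.locToRel (L.dd0 (τ j)), x⟩ :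
        AtomFact L (WitPoint M))) e
    rw [e'] at h
    exact h
  refine ⟨fun j => ⟨D.wit j, hwit j⟩, fun {m π} R x h => ?_⟩
  have h' := key ⟨m, π, R, x⟩ h
  have e : (fun i => pairVal D.par D.wit (x i)) = fun i =>
      (pairVal (Y := (factStruct F hF.const_mem).Dom) y (fun j => ⟨D.wit j, hwit j⟩) (x i)).1 := by
    funext i
    exact (map_pairVal (Y := (factStruct F hF.const_mem).Dom) (Z := WitPoint M)
      (fun s x => x.1) y (fun j => ⟨D.wit j, hwit j⟩) (x i)).symm
  change (⟨m, π, R, _⟩ : AtomFact L (WitPoint M)) ∈ F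
  rw [← e]
  exact h'

/-- Every local model maps to a positively closed one. -/
theorem LocalModel.exists_isPC {M : LStructure L} (hM : LocalModel M T) :
    ∃ N : LStructure L, IsPC N T ∧ Nonempty (LHom M N) := by
  classical
  let Gr : ∀ s, WitPoint M s → M.Dom s → Prop := fun s x m => x = .base m
  have hGr : ∀ s x m m', Gr s x m → Gr s x m' → m = m' := fun s x m m' h h' =>
    WitPoint.base.inj (h.symm.trans h')
  obtain ⟨F, hF₀, hF, hQ, hmax⟩ := exists_maximal_diagram (T := T) (k := WitPoint.const M)
    WitnessesSolve (by
      rintro c - - hc D j ⟨F, hF, hj⟩ f hf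
      exact ⟨F, hF, (hc F hF).2 D j hj f hf⟩)
    (pullFacts M Gr) (isDiagram_pullFacts hGr (fun s c => rfl) hM) (by
      intro D j hj
      obtain ⟨m, hm⟩ := (mem_factDom_pullFacts hM.1).1 hj
      exact absurd hm (D.wit_ne_base j m))
  have hmem : ∀ s (m : M.Dom s), WitPoint.base m ∈ factDom F s := fun s m =>
    hF₀ ((mem_factDom_pullFacts hM.1).2 ⟨m, rfl⟩)
  let P := hF.isPreLocal
  refine ⟨P.quot, ⟨P.quot_localModel, fun N h hN => ?_⟩, ⟨P.toQuot.comp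
    ⟨fun s m => ⟨.base m, hmem s m⟩, fun R x hx => hF₀ ⟨x, fun i => rfl, hx⟩, fun c => rfl⟩⟩⟩
  refine LHom.HasFinRetractions.isPosEmbedding fun Φ A hΦ hA hT => ?_
  obtain ⟨k, w, -, hw⟩ := (hΦ.biUnion fun φ _ => Set.finite_range
    fun i => (⟨φ.ρ i, φ.x i⟩ : Σ s, N.Dom s)).fin_param
  obtain ⟨n, a, -, ha⟩ := hA.fin_param
  choose y hy using fun i => P.toQuot_surjective _ (a i).2
  obtain ⟨b, hb⟩ := exists_solution hF hQ hmax hN (h.comp P.toQuot) y (fun j => (w j).2)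
  set u := fun i => (h.comp P.toQuot).toFun _ (y i)
  have hne : ∀ s, N.Dom s → Nonempty (P.quot.Dom s) := fun s m => by
    obtain ⟨b, -⟩ := exists_solution hF hQ hmax hN (h.comp P.toQuot) (ρ := Fin.elim0)
      (fun i => i.elim0) (fun _ : Fin 1 => m)
    exact ⟨P.toQuot.toFun _ (b 0)⟩
  have hg : ∀ s (m : N.Dom s), ∃ z : P.quot.Dom s, ∀ t, pairVal u (fun j => (w j).2) t = m →
      z = P.toQuot.toFun s (pairVal y b t) := by
    intro s m
    by_cases hm : ∃ t, pairVal u (fun j => (w j).2) t = m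
    · obtain ⟨t, rfl⟩ := hm
      refine ⟨_, fun t' ht' => Quotient.sound (s := P.setoid s) (a := pairVal y b t) ?_⟩
      have h' := hb (L.locToRel (L.dd0 s)) (dpair t t') (by
        rw [map_dpair (X := PairVar _ _) (fun s t => pairVal u (fun j => (w j).2) t) t t']
        exact (hN.1.dd0_eq _ _).2 ht'.symm)
      rwa [map_dpair (X := PairVar _ _) (fun s t => pairVal y b t) t t'] at h'
    · obtain ⟨z⟩ := hne s m
      exact ⟨z, fun t ht => absurd ⟨t, ht⟩ hm⟩
  choose g hg using hg
  refine ⟨g, fun φ hφ => ?_, fun p hp => ?_⟩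
  · have ht : ∀ i, ∃ t, pairVal u (fun j => (w j).2) t = φ.x i := by
      intro i
      have hi : (⟨φ.ρ i, φ.x i⟩ : Σ s, N.Dom s) ∈ Set.range w := by
        rw [hw]
        exact Set.mem_biUnion hφ ⟨i, rfl⟩
      have aux : ∀ p ∈ Set.range w, ∃ t, pairVal u (fun j => (w j).2) t = p.2 := by
        rintro _ ⟨j, rfl⟩
        exact ⟨PairVar.inr _ j, rfl⟩
      exact aux _ hi
    choose t ht using ht
    have h' := P.toQuot.map_rel _ _ (hb φ.R t (by
      simp only [ht]
      exact hT φ hφ))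
    simp only [← hg _ _ _ (ht _)] at h'
    exact h'
  · rw [← ha] at hp
    obtain ⟨i, rfl⟩ := hp
    refine (hg _ _ (PairVar.inl _ i) ?_).trans (hy i)
    change h.toFun _ (P.toQuot.toFun _ (y i)) = _
    rw [hy]

end Closure

/-! ## Maximal members of bounded compatibility classes -/

section Bounded

variable {L : LocalLanguage} {T : Set (PosSentence L)}

theorem IsPC.of_retract {A B : LStructure L} (hB : IsPC B T) (hA : LocalModel A T)
    (i : LHom A B) (j : LHom B A) (hij : j.comp i = LHom.id A) : IsPC A T := by
  refine ⟨hA, fun N h hN α σ φ v hv => ?_⟩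
  have e : ∀ a, j.toFun _ (i.toFun _ (v a)) = v a := fun a => LHom.congr_apply hij _ _
  have h' := j.realize φ _ (hB.2 N (h.comp j) hN α σ φ (fun a => i.toFun _ (v a)) (by
    simp only [LHom.comp, Function.comp_apply, e]
    exact hv))
  simpa only [e] using h'

section Transport

variable {X : L.Sorts → Type} {k : ∀ s, L.Const s → X s}

/-- `F` asserts no equality between distinct points and presents a positively closed model. -/
def PresentsPC (T : Set (PosSentence L)) (k : ∀ s, L.Const s → X s)
    (F : Set (AtomFact L X)) : Prop :=
  (∀ s (x y : X s), locFact (L.dd0 s) x y ∈ F → x = y) ∧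
    ∀ hk : ∀ s c, k s c ∈ factDom F s, IsPC (factStruct F hk) T

theorem IsDiagram.localModel {F : Set (AtomFact L X)} (hF : IsDiagram T k F)
    (h : ∀ s (x y : X s), locFact (L.dd0 s) x y ∈ F → x = y) :
    LocalModel (factStruct F hF.const_mem) T :=
  hF.isPreLocal.localModel fun _ _ hab => Subtype.ext (h _ _ _ (factStruct_locRel.1 hab))

theorem presentsPC_pullFacts {N : LStructure L} (hN : IsPC N T) {e : ∀ s, N.Dom s → X s}
    (he : ∀ s, Function.Injective (e s)) (hk : ∀ s c, e s (N.constMap c) = k s c) :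
    IsDiagram T k (pullFacts N fun s x n => e s n = x) ∧
      PresentsPC T k (pullFacts N fun s x n => e s n = x) := by
  have hGr : ∀ s x n n', e s n = x → e s n' = x → n = n' := fun s x n n' h h' =>
    he s (h.trans h'.symm)
  have hF := isDiagram_pullFacts (T := T) hGr hk hN.1
  obtain ⟨i, hi, hr⟩ := exists_hom_pullFacts hGr hk hN.1.1 hF.const_mem
  have hinj : ∀ s (x y : X s),
      locFact (L.dd0 s) x y ∈ pullFacts N (fun s x n => e s n = x) → x = y := by
    intro s x y hxy
    have h := i.map_locRel (a := ⟨x, hF.left_mem hxy⟩) (b := ⟨y, hF.right_mem hxy⟩) _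
      (factStruct_locRel.2 hxy)
    exact (hi s ⟨x, hF.left_mem hxy⟩).symm.trans
      ((congrArg (e s) ((hN.1.1.dd0_eq _ _).1 h)).trans (hi s ⟨y, hF.right_mem hxy⟩))
  refine ⟨hF, hinj, fun _ => hN.of_retract (hF.localModel hinj) i
    ⟨fun s n => ⟨e s n, (mem_factDom_pullFacts hN.1.1).2 ⟨n, rfl⟩⟩,
      fun R x hx => ⟨x, fun i => rfl, hx⟩, fun {s} c => Subtype.ext (hk s c)⟩
    (LHom.ext fun s x => Subtype.ext (hi s x))⟩

theorem PresentsPC.sUnion {c : Set (Set (AtomFact L X))} (hc : IsChain (· ⊆ ·) c)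
    (hne : c.Nonempty) (h : ∀ F ∈ c, IsDiagram T k F ∧ PresentsPC T k F) :
    PresentsPC T k (⋃₀ c) := by
  have hU := IsDiagram.sUnion hc hne fun F hF => (h F hF).1
  have hinj : ∀ s (x y : X s), locFact (L.dd0 s) x y ∈ ⋃₀ c → x = y := by
    rintro s x y ⟨F, hF, hxy⟩
    exact (h F hF).2.1 s x y hxy
  refine ⟨hinj, fun hk => ⟨hU.localModel hinj, fun N f hN => ?_⟩⟩
  refine LHom.HasFinRetractions.isPosEmbedding fun Φ A hΦ hA hT => ?_
  obtain ⟨F, hF, hS⟩ := DirectedOn.exists_mem_subset_of_finite_of_subset_sUnion hne hc.directedOn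
    (hA.image fun a : Σ s, (factStruct (⋃₀ c) hk).Dom s =>
      locFact (X := X) (L.dd0 a.1) a.2.1 a.2.1) (by
      rintro _ ⟨a, -, rfl⟩
      exact a.2.2)
  have hF' := (h F hF).2.2 (h F hF).1.const_mem
  let i := factStruct.incl (Set.subset_sUnion_of_mem hF) (h F hF).1.const_mem hk
  obtain ⟨g, hg, hgi⟩ := (hF'.2 N (f.comp i) hN).exists_retraction hF'.1.1 hN.1 Φ hΦ hT
  refine ⟨fun s n => i.toFun s (g s n), fun φ hφ => i.map_rel _ _ (hg φ hφ), fun a ha => ?_⟩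
  exact congrArg (i.toFun a.1) (hgi a.1 ⟨a.2.1, hS ⟨a, ha, rfl⟩⟩)

end Transport

theorem exists_injective_extension {Λ B : Type} (D : Set Λ) (f : D → B)
    (hf : Function.Injective f) (h : Cardinal.mk B ≤ Cardinal.mk (Dᶜ : Set Λ)) :
    ∃ e : B → Λ, Function.Injective e ∧ ∀ x, e (f x) = x.1 := by
  classical
  obtain ⟨j⟩ := Cardinal.le_def _ _ |>.1 h
  let e : B → Λ := fun b => if hb : ∃ x, f x = b then (hb.choose).1 else (j b).1
  have hef : ∀ x, e (f x) = x.1 := by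
    intro x
    have hx : ∃ y, f y = f x := ⟨x, rfl⟩
    simp only [e, dif_pos hx]
    exact congrArg Subtype.val (hf hx.choose_spec)
  have hen : ∀ b, (¬ ∃ x, f x = b) → e b = (j b).1 := fun b hb => dif_neg hb
  refine ⟨e, fun b b' hbb' => ?_, hef⟩
  by_cases hb : ∃ x, f x = b <;> by_cases hb' : ∃ x, f x = b'
  · obtain ⟨x, rfl⟩ := hb
    obtain ⟨x', rfl⟩ := hb'
    rw [hef, hef] at hbb'
    exact congrArg f (Subtype.ext hbb')
  · obtain ⟨x, rfl⟩ := hb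
    rw [hef, hen _ hb'] at hbb'
    exact absurd x.2 (hbb' ▸ (j b').2)
  · obtain ⟨x', rfl⟩ := hb'
    rw [hef, hen _ hb] at hbb'
    exact absurd x'.2 (hbb' ▸ (j b).2)
  · rw [hen _ hb, hen _ hb'] at hbb'
    exact j.injective (Subtype.ext hbb')

theorem LStructure.mk_dom_le_card (M : LStructure L) (s : L.Sorts) :
    Cardinal.mk (M.Dom s) ≤ M.card :=
  Cardinal.mk_le_of_injective (f := fun x => (⟨s, x⟩ : Σ s, M.Dom s)) sigma_mk_injective

theorem LHom.IsPosEmbedding.card_le {M N : LStructure L} {f : LHom M N} (hf : f.IsPosEmbedding)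
    (hM : IsLocal M) (hN : IsLocal N) : M.card ≤ N.card :=
  Cardinal.mk_le_of_injective
    (Function.injective_id.sigma_map fun s => hf.injective hM hN s)

/-- A bounded compatibility class has a member all of whose homomorphisms to members of the
class are surjective. -/
theorem IsPC.exists_hom_surjective {M₀ : LStructure L} (hM₀ : IsPC M₀ T) (κ : Cardinal)
    (hκ : ∀ B : LStructure L, IsPC B T → Compat T M₀ B → B.card ≤ κ) :
    ∃ C : LStructure L, IsPC C T ∧ Compat T M₀ C ∧
      ∀ B : LStructure L, IsPC B T → Compat T M₀ B → ∀ (f : LHom C B) (s : L.Sorts),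
        Function.Surjective (f.toFun s) := by
  let Λ := (Σ s, M₀.Dom s) ⊕ Set κ.out ⊕ ℕ
  have hΛ : κ < Cardinal.mk Λ := by
    calc κ = Cardinal.mk κ.out := (Cardinal.mk_out κ).symm
      _ < Cardinal.mk (Set κ.out) := by
        rw [Cardinal.mk_set]
        exact Cardinal.cantor _
      _ ≤ Cardinal.mk Λ := Cardinal.mk_le_of_injective
        (f := fun x => (.inr (.inl x) : Λ)) (Sum.inr_injective.comp Sum.inl_injective)
  let e₀ : ∀ s, M₀.Dom s → Λ := fun s m => .inl ⟨s, m⟩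
  let k : ∀ s, L.Const s → Λ := fun s c => e₀ s (M₀.constMap c)
  obtain ⟨hD₀, hQ₀⟩ := presentsPC_pullFacts (X := fun _ => Λ) (k := k) hM₀ (e := e₀)
    (fun s => Sum.inl_injective.comp sigma_mk_injective) (fun s c => rfl)
  obtain ⟨F, hF₀, hF, hQ, hmax⟩ := exists_maximal_diagram (PresentsPC T k)
    (fun c hc hne h => PresentsPC.sUnion hc hne h) _ hD₀ hQ₀
  have hC := hQ.2 hF.const_mem
  have hmem : ∀ s m, e₀ s m ∈ factDom F s := fun s m =>
    factDom_mono hF₀ s ((mem_factDom_pullFacts hM₀.1.1).2 ⟨m, rfl⟩)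
  have hMC : Compat T M₀ (factStruct F hF.const_mem) :=
    ⟨_, hC.1, ⟨⟨fun s m => ⟨e₀ s m, hmem s m⟩,
      fun R x hx => hF₀ ⟨x, fun i => rfl, hx⟩, fun c => rfl⟩⟩, ⟨LHom.id _⟩⟩
  refine ⟨_, hC, hMC, fun B hB hMB f => ?_⟩
  have he : ∀ s, ∃ e : B.Dom s → Λ, Function.Injective e ∧
      ∀ x : (factStruct F hF.const_mem).Dom s, e (f.toFun s x) = x.1 := by
    intro s
    refine exists_injective_extension (factDom F s) (f.toFun s)
      ((hC.2 B f hB.1).injective hC.1.1 hB.1.1 s) ?_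
    have hlt : Cardinal.mk (factDom F s) < Cardinal.mk Λ :=
      (((factStruct F hF.const_mem).mk_dom_le_card s).trans (hκ _ hC hMC)).trans_lt hΛ
    rw [Cardinal.mk_compl_of_infinite _ hlt]
    exact ((B.mk_dom_le_card s).trans (hκ B hB hMB)).trans hΛ.le
  choose e he hef using he
  obtain ⟨hF', hQ'⟩ := presentsPC_pullFacts (X := fun _ => Λ) (k := k) hB he (fun s c => by
    rw [← f.map_const, hef]
    rfl)
  have hsub := hmax _ hF' hQ' fun φ hφ =>
    ⟨fun i => f.toFun _ ⟨φ.x i, hF.support φ hφ i⟩, fun i => hef _ _, f.map_rel φ.R _ hφ⟩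
  intro s b
  have hb : e s b ∈ factDom F s :=
    factDom_mono hsub s ((mem_factDom_pullFacts hB.1.1).2 ⟨b, rfl⟩)
  exact ⟨⟨e s b, hb⟩, he s (hef s ⟨e s b, hb⟩)⟩

theorem LHom.IsPosEmbedding.exists_inverse {M N : LStructure L} {f : LHom M N}
    (hf : f.IsPosEmbedding) (hM : IsLocal M) (hN : IsLocal N)
    (hs : ∀ s, Function.Surjective (f.toFun s)) : ∃ g : LHom N M, g.comp f = LHom.id M := by
  choose g hg using hs
  refine ⟨⟨g, fun R x hx => hf.reflects R _ (by simpa only [hg] using hx), fun {s} c => ?_⟩,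
    LHom.ext fun s x => hf.injective hM hN s (hg s _)⟩
  refine hf.injective hM hN s ?_
  rw [hg, f.map_const]

/-- A bounded compatibility class contains a retractor. -/
theorem IsPC.exists_isRetractor {M₀ : LStructure L} (hM₀ : IsPC M₀ T) (κ : Cardinal)
    (hκ : ∀ B : LStructure L, IsPC B T → Compat T M₀ B → B.card ≤ κ) :
    ∃ C : LStructure L, IsPC C T ∧ Compat T M₀ C ∧ IsRetractor T C := by
  obtain ⟨C, hC, hMC, hs⟩ := hM₀.exists_hom_surjective κ hκ
  refine ⟨C, hC, hMC, hC.1, fun N hN f => ?_⟩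
  obtain ⟨B, hB, ⟨u⟩⟩ := hN.exists_isPC
  obtain ⟨v, hv⟩ := (hC.2 B (u.comp f) hB.1).exists_inverse hC.1.1 hB.1.1
    (hs B hB (hC.compat_of_hom hMC.symm (u.comp f) hB.1) (u.comp f))
  exact ⟨v.comp u, hv⟩

/-- A retractor receives a homomorphism from every compatible structure. -/
theorem IsRetractor.nonempty_hom {C N : LStructure L} (hC : IsRetractor T C)
    (h : Compat T C N) : Nonempty (LHom N C) := by
  obtain ⟨P, hP, ⟨f⟩, ⟨g⟩⟩ := h
  obtain ⟨r, -⟩ := hC.2 P hP f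
  exact ⟨r.comp g⟩

/-- A one-sided inverse of a homomorphism from a positively closed model is two-sided. -/
theorem IsPC.comp_eq_id {C D : LStructure L} (hC : IsPC C T) (hD : LocalModel D T)
    {i : LHom D C} {r : LHom C D} (h : r.comp i = LHom.id D) : i.comp r = LHom.id C :=
  LHom.ext fun s x => (hC.2 D r hD).injective hC.1.1 hD.1 s (LHom.congr_apply h s (r.toFun s x))

end Bounded

/-- Let `E` be the compatibility class of a local positively closed
model `M₀` of `T`.  Then (1) a member `C` of `E` is a retractor of `T` iff it is
absolutely universal for `E`; (2) there is at most one retractor in `E` up to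
isomorphism; (3) there is a retractor in `E` iff `E` is bounded in cardinality. -/
theorem retractor_in_compatibility_class
    {L : LocalLanguage} (T : Set (PosSentence L))
    (hT : IsNegLocalTheory T) (hsat : LocSat T)
    (M₀ : LStructure L) (hM₀ : IsPC M₀ T) :
    (∀ C : LStructure L, IsPC C T → Compat T M₀ C →
        (IsRetractor T C ↔
          IsAbsUniversal C (fun B => IsPC B T ∧ Compat T M₀ B))) ∧
    (∀ C₁ C₂ : LStructure L, IsPC C₁ T → Compat T M₀ C₁ → IsPC C₂ T → Compat T M₀ C₂ →
        IsRetractor T C₁ → IsRetractor T C₂ → Isomorphic C₁ C₂) ∧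
    ((∃ C : LStructure L, IsPC C T ∧ Compat T M₀ C ∧ IsRetractor T C) ↔
        ∃ κ : Cardinal, ∀ B : LStructure L, IsPC B T → Compat T M₀ B → B.card ≤ κ) := by
  have hbdd : ∀ C : LStructure L, IsPC C T →
      IsAbsUniversal C (fun B => IsPC B T ∧ Compat T M₀ B) →
      ∀ B : LStructure L, IsPC B T → Compat T M₀ B → B.card ≤ C.card := by
    intro C hC hU B hB hMB
    obtain ⟨f⟩ := hU B ⟨hB, hMB⟩
    exact (hB.2 C f hC.1).card_le hB.1.1 hC.1.1
  have huniv : ∀ C : LStructure L, Compat T M₀ C → IsRetractor T C →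
      IsAbsUniversal C (fun B => IsPC B T ∧ Compat T M₀ B) := by
    intro C hMC hR B hB
    exact hR.nonempty_hom (hM₀.compat_trans hMC hB.2)
  refine ⟨fun C hC hMC => ⟨huniv C hMC, fun hU => ⟨hC.1, fun N hN f => ?_⟩⟩, ?_, ?_, ?_⟩
  · obtain ⟨D, hD, hMD, hDR⟩ := hM₀.exists_isRetractor C.card (hbdd C hC hU)
    obtain ⟨i⟩ := hU D ⟨hD, hMD⟩
    obtain ⟨r, hr⟩ := hDR.2 C hC.1 i
    obtain ⟨q, hq⟩ := hDR.2 N hN (f.comp i)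
    refine ⟨i.comp q, LHom.ext fun s x => ?_⟩
    have hx := LHom.congr_apply (hC.comp_eq_id hD.1 hr) s x
    calc i.toFun s (q.toFun s (f.toFun s x))
        = i.toFun s (q.toFun s (f.toFun s (i.toFun s (r.toFun s x)))) := by
          exact congrArg (fun z => i.toFun s (q.toFun s (f.toFun s z))) hx.symm
      _ = i.toFun s (r.toFun s x) := congrArg (i.toFun s) (LHom.congr_apply hq s _)
      _ = x := hx
  · intro C₁ C₂ hC₁ hMC₁ hC₂ hMC₂ hR₁ hR₂
    obtain ⟨a⟩ := huniv C₂ hMC₂ hR₂ C₁ ⟨hC₁, hMC₁⟩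
    obtain ⟨b, hb⟩ := hR₁.2 C₂ hC₂.1 a
    exact ⟨a, b, hb, hC₂.comp_eq_id hC₁.1 hb⟩
  · rintro ⟨C, hC, hMC, hR⟩
    exact ⟨C.card, hbdd C hC (huniv C hMC hR)⟩
  · rintro ⟨κ, hκ⟩
    exact hM₀.exists_isRetractor κ hκ
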